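/- For every L ≥ 2 there exist positive constants c(L) and C(L), depending only on L, such that for every doubling 2π-periodic weight function W with doubling constant L and every integer n ≥ 1: (i) every Chebyshev-type trigonometric quadrature of degree n for W has at least c(L)·R^trig_W(n) nodes, and (ii) for every integer N ≥ C(L)·R^trig_W(n) there exists a Chebyshev-type trigonometric quadrature of degree n for W with exactly N nodes. -/

import Mathlib

open MeasureTheory Real Set

noncomputable section

/-- A trigonometric polynomial of degree at most `n`. -/
def IsTrigPoly (n : ℕ) (p : ℝ → ℝ) : Prop :=
  ∃ a b : ℕ → ℝ, ∀ θ : ℝ,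
    p θ = a 0 + ∑ k ∈ Finset.Icc 1 n, (a k * Real.cos (k * θ) + b k * Real.sin (k * θ))

/-- A `2π`-periodic weight function. -/
def IsPeriodicWeight (W : ℝ → ℝ) : Prop :=
  Measurable W ∧ (∀ θ, 0 ≤ W θ) ∧ Function.Periodic W (2 * π) ∧
  IntervalIntegrable W volume (-π) π ∧ 0 < ∫ θ in (-π)..π, W θ

/-- `W` is doubling with doubling constant `L`. -/
def IsDoublingPeriodic (W : ℝ → ℝ) (L : ℝ) : Prop :=
  ∀ δ : ℝ, 0 < δ → ∀ a : ℝ,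
    (∫ θ in (a - 2*δ)..(a + 2*δ), W θ) ≤ L * ∫ θ in (a - δ)..(a + δ), W θ

/-- A Chebyshev-type trigonometric quadrature of degree `n` for `W` with `N` nodes. -/
def IsTrigChebQuad (W : ℝ → ℝ) (n N : ℕ) (θs : Fin N → ℝ) : Prop :=
  Monotone θs ∧
  ∀ p : ℝ → ℝ, IsTrigPoly n p →
    (∫ θ in (-π)..π, p θ * W θ) =
      ((∫ θ in (-π)..π, W θ) / N) * ∑ i, p (θs i)

/-- `R^trig_W(n)`. -/
def Rtrig (W : ℝ → ℝ) (n : ℕ) : ℝ :=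
  (∫ θ in (-π)..π, W θ) /
    sInf (Set.range fun x : ℝ => ∫ θ in (x - 1/n)..(x + 1/n), W θ)


namespace IsTrigPoly

variable {m n : ℕ} {p q : ℝ → ℝ}

theorem const (n : ℕ) (c : ℝ) : IsTrigPoly n fun _ => c :=
  ⟨fun k => if k = 0 then c else 0, 0, fun θ => by simp⟩

theorem add (hp : IsTrigPoly n p) (hq : IsTrigPoly n q) : IsTrigPoly n fun θ => p θ + q θ := by
  obtain ⟨a, b, h⟩ := hp
  obtain ⟨a', b', h'⟩ := hq
  refine ⟨a + a', b + b', fun θ => ?_⟩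
  simp only [h, h']
  rw [add_add_add_comm, ← Finset.sum_add_distrib]
  simp only [Pi.add_apply]
  congr 1
  exact Finset.sum_congr rfl fun k _ => by ring

theorem const_mul (c : ℝ) (hp : IsTrigPoly n p) : IsTrigPoly n fun θ => c * p θ := by
  obtain ⟨a, b, h⟩ := hp
  refine ⟨fun k => c * a k, fun k => c * b k, fun θ => ?_⟩
  simp only [h]
  rw [mul_add, Finset.mul_sum]
  congr 1
  exact Finset.sum_congr rfl fun k _ => by ring

theorem sum {ι : Type*} (s : Finset ι) {f : ι → ℝ → ℝ} (h : ∀ i ∈ s, IsTrigPoly n (f i)) :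
    IsTrigPoly n fun θ => ∑ i ∈ s, f i θ := by
  classical
  induction s using Finset.induction_on with
  | empty => simpa using const n 0
  | insert i s hi ih =>
    simp only [Finset.sum_insert hi]
    exact (h i (Finset.mem_insert_self i s)).add
      (ih fun j hj => h j (Finset.mem_insert_of_mem hj))

theorem cos_nat {k : ℕ} (hk : k ≤ n) : IsTrigPoly n fun θ => Real.cos (k * θ) := by
  rcases Nat.eq_zero_or_pos k with rfl | h0
  · simpa using const n 1
  refine ⟨Pi.single k 1, 0, fun θ => ?_⟩
  rw [Finset.sum_eq_single_of_mem k (Finset.mem_Icc.2 ⟨h0, hk⟩) fun j _ hj => by simp [hj]]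
  simp [h0.ne]

theorem sin_nat {k : ℕ} (hk : k ≤ n) : IsTrigPoly n fun θ => Real.sin (k * θ) := by
  rcases Nat.eq_zero_or_pos k with rfl | h0
  · simpa using const n 0
  refine ⟨0, Pi.single k 1, fun θ => ?_⟩
  rw [Finset.sum_eq_single_of_mem k (Finset.mem_Icc.2 ⟨h0, hk⟩) fun j _ hj => by simp [hj]]
  simp

theorem cos_add {k : ℤ} (hk : k.natAbs ≤ n) (φ : ℝ) :
    IsTrigPoly n fun θ => Real.cos (k * θ + φ) := by
  rcases Int.natAbs_eq k with h | h
  · have := ((cos_nat hk).const_mul (Real.cos φ)).add ((sin_nat hk).const_mul (-Real.sin φ))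
    convert this using 2 with θ
    rw [h, Real.cos_add]
    simp only [Int.natAbs_natCast, Int.cast_natCast]
    ring
  · have := ((cos_nat hk).const_mul (Real.cos φ)).add ((sin_nat hk).const_mul (Real.sin φ))
    convert this using 2 with θ
    rw [h, Real.cos_add]
    simp only [Int.natAbs_neg, Int.natAbs_natCast, Int.cast_natCast, Int.cast_neg, neg_mul,
      Real.cos_neg, Real.sin_neg]
    ring

theorem induction {motive : (ℝ → ℝ) → Prop}
    (cos_add : ∀ k : ℕ, k ≤ n → ∀ φ, motive fun θ => Real.cos (k * θ + φ))
    (add : ∀ p q, motive p → motive q → motive fun θ => p θ + q θ)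
    (const_mul : ∀ (c : ℝ) p, motive p → motive fun θ => c * p θ)
    (hp : IsTrigPoly n p) : motive p := by
  obtain ⟨a, b, h⟩ := hp
  have hconst : ∀ c : ℝ, motive fun _ => c := fun c => by
    simpa using const_mul c _ (cos_add 0 (Nat.zero_le n) 0)
  have hsin : ∀ k : ℕ, k ≤ n → motive fun θ => Real.sin (k * θ) := fun k hk => by
    simpa [← sub_eq_add_neg, Real.cos_sub_pi_div_two] using cos_add k hk (-(π / 2))
  have hcos : ∀ k : ℕ, k ≤ n → motive fun θ => Real.cos (k * θ) := fun k hk => by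
    simpa using cos_add k hk 0
  have hsum : ∀ s : Finset ℕ, (∀ k ∈ s, k ≤ n) →
      motive fun θ => ∑ k ∈ s, (a k * Real.cos (k * θ) + b k * Real.sin (k * θ)) := by
    intro s hs
    induction s using Finset.induction_on with
    | empty => simpa using hconst 0
    | insert i s hi ih =>
      simp only [Finset.sum_insert hi]
      refine add _ _ (add _ _ ?_ ?_) (ih fun k hk => hs k (Finset.mem_insert_of_mem hk))
      · exact const_mul _ _ (hcos i (hs i (Finset.mem_insert_self i s)))
      · exact const_mul _ _ (hsin i (hs i (Finset.mem_insert_self i s)))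
  rw [funext h]
  exact add _ _ (hconst _) (hsum _ fun k hk => (Finset.mem_Icc.1 hk).2)

theorem mono (hmn : m ≤ n) (hp : IsTrigPoly m p) : IsTrigPoly n p := by
  refine hp.induction (fun k hk φ => ?_) (fun p q => add) fun c p => const_mul c
  exact cos_add (k := k) (by simpa using hk.trans hmn) φ

theorem comp_sub (hp : IsTrigPoly n p) (x : ℝ) : IsTrigPoly n fun θ => p (θ - x) := by
  refine hp.induction (motive := fun p => IsTrigPoly n fun θ => p (θ - x))
    (fun k hk φ => ?_) (fun p q => add) fun c p => const_mul c
  convert cos_add (n := n) (k := k) (by simpa using hk) (φ - k * x) using 3 with θ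
  push_cast
  ring

theorem mul (hp : IsTrigPoly m p) (hq : IsTrigPoly n q) :
    IsTrigPoly (m + n) fun θ => p θ * q θ := by
  refine hp.induction (motive := fun p => IsTrigPoly (m + n) fun θ => p θ * q θ)
    (fun k hk φ => ?_) (fun p q hp hq => ?_) fun c p hp => ?_
  · refine hq.induction (motive := fun q => IsTrigPoly (m + n) fun θ => Real.cos (k * θ + φ) * q θ)
      (fun l hl ψ => ?_) (fun p q hp hq => ?_) fun c p hp => ?_
    · have h₁ := cos_add (n := m + n) (k := k - l) (by omega) (φ - ψ)
      have h₂ := cos_add (n := m + n) (k := k + l) (by omega) (φ + ψ)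
      convert (h₁.add h₂).const_mul (1 / 2) using 2 with θ
      have e₁ : ((k - l : ℤ) : ℝ) * θ + (φ - ψ) = (k * θ + φ) - (l * θ + ψ) := by
        push_cast; ring
      have e₂ : ((k + l : ℤ) : ℝ) * θ + (φ + ψ) = (k * θ + φ) + (l * θ + ψ) := by
        push_cast; ring
      rw [e₁, e₂, Real.cos_sub (k * θ + φ), Real.cos_add (k * θ + φ)]
      ring
    · simpa only [mul_add] using hp.add hq
    · simpa only [mul_left_comm] using hp.const_mul c
  · simpa only [add_mul] using hp.add hq
  · simpa only [mul_assoc] using hp.const_mul c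

theorem pow (hp : IsTrigPoly n p) (k : ℕ) : IsTrigPoly (k * n) fun θ => p θ ^ k := by
  induction k with
  | zero => simpa using const 0 1
  | succ k ih => simpa only [pow_succ, Nat.succ_mul] using ih.mul hp

theorem contDiff (hp : IsTrigPoly n p) : ContDiff ℝ 1 p :=
  hp.induction (motive := ContDiff ℝ 1) (fun k hk φ => by fun_prop) (fun _ _ => ContDiff.add)
    fun _ _ => contDiff_const.mul

theorem differentiable (hp : IsTrigPoly n p) : Differentiable ℝ p :=
  hp.contDiff.differentiable one_ne_zero

theorem continuous (hp : IsTrigPoly n p) : Continuous p := hp.contDiff.continuous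

theorem periodic (hp : IsTrigPoly n p) : Function.Periodic p (2 * π) := by
  refine hp.induction (motive := fun p => Function.Periodic p (2 * π)) (fun k hk φ θ => ?_)
    (fun p q hp hq θ => by simp only [hp θ, hq θ]) fun c p hp θ => by simp only [hp θ]
  have : (k : ℝ) * (θ + 2 * π) + φ = k * θ + φ + k * (2 * π) := by ring
  simp only [this, Real.cos_add_nat_mul_two_pi]

theorem deriv (hp : IsTrigPoly n p) : IsTrigPoly n (deriv p) := by
  refine (hp.induction (motive := fun p => Differentiable ℝ p ∧ IsTrigPoly n (_root_.deriv p))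
    (fun k hk φ => ⟨by fun_prop, ?_⟩) (fun p q hp hq => ⟨hp.1.add hq.1, ?_⟩)
    fun c p hp => ⟨hp.1.const_mul c, ?_⟩).2
  · have h : ∀ θ : ℝ, HasDerivAt (fun θ : ℝ => Real.cos (k * θ + φ))
        (k * Real.cos (k * θ + (φ + π / 2))) θ := fun θ => by
      have := (((hasDerivAt_id' θ).const_mul (k : ℝ)).add_const φ).cos
      convert this using 1
      rw [← add_assoc, Real.cos_add_pi_div_two]
      simp
      ring
    rw [show _root_.deriv _ = _ from funext fun θ => (h θ).deriv]
    exact (cos_add (k := k) (by simpa using hk) _).const_mul _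
  · rw [show _root_.deriv _ = _ from funext fun θ => deriv_fun_add (hp.1 θ) (hq.1 θ)]
    exact hp.2.add hq.2
  · rw [show _root_.deriv _ = _ from funext fun θ => deriv_const_mul c (hp.1 θ)]
    exact hp.2.const_mul c

theorem exists_bound (hp : IsTrigPoly n p) : ∃ B, ∀ θ, |p θ| ≤ B := by
  refine hp.induction (motive := fun p => ∃ B, ∀ θ, |p θ| ≤ B)
    (fun k hk φ => ⟨1, fun θ => Real.abs_cos_le_one _⟩) ?_ ?_
  · rintro p q ⟨B, hB⟩ ⟨B', hB'⟩
    exact ⟨B + B', fun θ => (abs_add_le _ _).trans (add_le_add (hB θ) (hB' θ))⟩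
  · rintro c p ⟨B, hB⟩
    exact ⟨|c| * B, fun θ => by
      rw [abs_mul]
      exact mul_le_mul_of_nonneg_left (hB θ) (abs_nonneg c)⟩

end IsTrigPoly

/-- The mass that `W` gives to the interval of radius `δ` around `x`. -/
def windowMass (W : ℝ → ℝ) (δ x : ℝ) : ℝ := ∫ θ in (x - δ)..(x + δ), W θ

/-- The mean over one period of the window integrals of a periodic function. -/
theorem Function.Periodic.integral_windowMass {G : ℝ → ℝ} (hG : Function.Periodic G (2 * π))
    (hi : ∀ a b, IntervalIntegrable G volume a b) (η : ℝ) :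
    ∫ x in (-π)..π, windowMass G η x = 2 * η * ∫ θ in (-π)..π, G θ := by
  set F : ℝ → ℝ := fun x => ∫ θ in (0 : ℝ)..x, G θ with hF
  have hFc : Continuous F := intervalIntegral.continuous_primitive hi 0
  have hFi : ∀ a b, IntervalIntegrable F volume a b := fun a b => hFc.intervalIntegrable a b
  have hper : ∀ x, F (x + 2 * π) = F x + ∫ θ in (-π)..π, G θ := fun x => by
    have h := hG.intervalIntegral_add_eq x (-π)
    rw [show -π + 2 * π = π by ring] at h
    rw [hF, ← h]
    exact (intervalIntegral.integral_add_adjacent_intervals (hi _ _) (hi _ _)).symm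
  have hshift : ∀ η, ∫ x in (-π)..π, F (x + η) =
      (∫ x in (-π)..π, F x) + η * ∫ θ in (-π)..π, G θ := fun η => by
    have h₁ : ∫ x in π..(π + η), F x =
        (∫ x in (-π)..(-π + η), F x) + η * ∫ θ in (-π)..π, G θ := by
      have : ∫ x in (-π)..(-π + η), F (x + 2 * π) = ∫ x in π..(π + η), F x := by
        rw [intervalIntegral.integral_comp_add_right]
        congr 1 <;> ring
      rw [← this]
      simp only [hper]
      rw [intervalIntegral.integral_add (hFi _ _) (by simp)]
      simp
    rw [intervalIntegral.integral_comp_add_right]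
    have h₂ := intervalIntegral.integral_add_adjacent_intervals (hFi (-π) (-π + η))
      (hFi (-π + η) (π + η))
    have h₃ := intervalIntegral.integral_add_adjacent_intervals (hFi (-π) π) (hFi π (π + η))
    linarith
  have hw : ∀ x, windowMass G η x = F (x + η) - F (x + -η) := fun x => by
    rw [windowMass, hF, intervalIntegral.integral_interval_sub_left (hi _ _) (hi _ _),
      sub_eq_add_neg]
  simp only [hw]
  rw [intervalIntegral.integral_sub, hshift, hshift]
  · ring
  · exact (hFc.comp (continuous_add_const η)).intervalIntegrable _ _
  · exact (hFc.comp (continuous_add_const (-η))).intervalIntegrable _ _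

theorem continuous_windowMass_of_intervalIntegrable {G : ℝ → ℝ}
    (hi : ∀ a b, IntervalIntegrable G volume a b) (η : ℝ) : Continuous (windowMass G η) := by
  have hc := intervalIntegral.continuous_primitive hi 0
  have : windowMass G η = fun x =>
      (∫ θ in (0 : ℝ)..(x + η), G θ) - ∫ θ in (0 : ℝ)..(x - η), G θ := by
    ext x
    rw [windowMass, intervalIntegral.integral_interval_sub_left (hi _ _) (hi _ _)]
  rw [this]
  exact (hc.comp (continuous_add_const η)).sub (hc.comp (continuous_sub_right η))

theorem IsDoublingPeriodic.windowMass_two_pow_mul_le {W : ℝ → ℝ} {L δ : ℝ}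
    (hd : IsDoublingPeriodic W L) (hL : 0 ≤ L) (hδ : 0 < δ) (k : ℕ) (x : ℝ) :
    windowMass W (2 ^ k * δ) x ≤ L ^ k * windowMass W δ x := by
  induction k with
  | zero => simp
  | succ k ih =>
    calc windowMass W (2 ^ (k + 1) * δ) x = windowMass W (2 * (2 ^ k * δ)) x := by
          rw [pow_succ]; congr 1; ring
      _ ≤ L * windowMass W (2 ^ k * δ) x := hd _ (by positivity) x
      _ ≤ L * (L ^ k * windowMass W δ x) := mul_le_mul_of_nonneg_left ih hL
      _ = L ^ (k + 1) * windowMass W δ x := by ring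

namespace IsPeriodicWeight

variable {W : ℝ → ℝ} {L δ η : ℝ}

theorem nonneg (hW : IsPeriodicWeight W) (θ : ℝ) : 0 ≤ W θ := hW.2.1 θ

theorem periodic (hW : IsPeriodicWeight W) : Function.Periodic W (2 * π) := hW.2.2.1

theorem integral_pos (hW : IsPeriodicWeight W) : 0 < ∫ θ in (-π)..π, W θ := hW.2.2.2.2

theorem intervalIntegrable (hW : IsPeriodicWeight W) (a b : ℝ) :
    IntervalIntegrable W volume a b :=
  hW.periodic.intervalIntegrable (t := -π) (by positivity)
    (by rw [show -π + 2 * π = π by ring]; exact hW.2.2.2.1) a b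

theorem intervalIntegrable_mul (hW : IsPeriodicWeight W) {g : ℝ → ℝ} (hg : Continuous g)
    (a b : ℝ) : IntervalIntegrable (fun θ => g θ * W θ) volume a b :=
  (hW.intervalIntegrable a b).continuousOn_mul hg.continuousOn

theorem integral_mul_nonneg (hW : IsPeriodicWeight W) {g : ℝ → ℝ} (hg : ∀ θ, 0 ≤ g θ) {a b : ℝ}
    (hab : a ≤ b) : 0 ≤ ∫ θ in a..b, g θ * W θ :=
  intervalIntegral.integral_nonneg hab fun θ _ => mul_nonneg (hg θ) (hW.nonneg θ)

theorem integral_mul_mono (hW : IsPeriodicWeight W) {g g' : ℝ → ℝ} (hg : Continuous g)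
    (hg' : Continuous g') {a b : ℝ} (hab : a ≤ b) (h : ∀ θ ∈ Icc a b, g θ ≤ g' θ) :
    ∫ θ in a..b, g θ * W θ ≤ ∫ θ in a..b, g' θ * W θ :=
  intervalIntegral.integral_mono_on hab (hW.intervalIntegrable_mul hg a b)
    (hW.intervalIntegrable_mul hg' a b)
    fun θ hθ => mul_le_mul_of_nonneg_right (h θ hθ) (hW.nonneg θ)

theorem windowMass_nonneg (hW : IsPeriodicWeight W) (hδ : 0 ≤ δ) (x : ℝ) : 0 ≤ windowMass W δ x :=
  intervalIntegral.integral_nonneg (by linarith) fun θ _ => hW.nonneg θ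

theorem windowMass_mono (hW : IsPeriodicWeight W) {x y : ℝ} (hη : 0 ≤ η)
    (h : |x - y| + η ≤ δ) : windowMass W η y ≤ windowMass W δ x := by
  have := abs_le.1 (show |x - y| ≤ δ - η by linarith)
  exact intervalIntegral.integral_mono_interval (by linarith) (by linarith) (by linarith)
    (Filter.Eventually.of_forall hW.nonneg) (hW.intervalIntegrable _ _)

theorem continuous_windowMass (hW : IsPeriodicWeight W) (δ : ℝ) : Continuous (windowMass W δ) :=
  continuous_windowMass_of_intervalIntegrable hW.intervalIntegrable δ

theorem periodic_windowMass (hW : IsPeriodicWeight W) (δ : ℝ) :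
    Function.Periodic (windowMass W δ) (2 * π) := fun x => by
  have : ∫ θ in (x - δ)..(x + δ), W (θ + 2 * π) = ∫ θ in (x - δ)..(x + δ), W θ := by
    simp only [hW.periodic _]
  rw [windowMass, windowMass, ← this, intervalIntegral.integral_comp_add_right]
  congr 1 <;> ring

theorem windowMass_le_of_two_pow (hW : IsPeriodicWeight W) (hd : IsDoublingPeriodic W L)
    (hL : 0 ≤ L) (hη : 0 < η) (hδ : 0 ≤ δ) {k : ℕ} (hk : δ ≤ 2 ^ k * η) (x : ℝ) :
    windowMass W δ x ≤ L ^ k * windowMass W η x :=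
  (hW.windowMass_mono hδ (by simpa using hk)).trans (hd.windowMass_two_pow_mul_le hL hη k x)

theorem windowMass_growth (hW : IsPeriodicWeight W) (hd : IsDoublingPeriodic W L)
    (hL : 0 ≤ L) {s : ℕ} (hs : L ≤ 2 ^ s) (hδ : 0 < δ) (x y : ℝ) :
    windowMass W δ y ≤ (2 * (1 + |x - y| / δ)) ^ s * windowMass W δ x := by
  obtain ⟨k, hk, hk'⟩ := exists_nat_pow_near (x := 1 + |x - y| / δ) (y := (2 : ℝ))
    (by have : 0 ≤ |x - y| / δ := by positivity
        linarith) one_lt_two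
  have h₁ : |x - y| + δ ≤ 2 ^ (k + 1) * δ := by
    have := mul_le_mul_of_nonneg_right hk'.le hδ.le
    rwa [add_mul, div_mul_cancel₀ _ hδ.ne', one_mul, add_comm] at this
  calc windowMass W δ y ≤ windowMass W (2 ^ (k + 1) * δ) x := hW.windowMass_mono hδ.le h₁
    _ ≤ L ^ (k + 1) * windowMass W δ x := hd.windowMass_two_pow_mul_le hL hδ _ x
    _ ≤ (2 * (1 + |x - y| / δ)) ^ s * windowMass W δ x := by
      refine mul_le_mul_of_nonneg_right ?_ (hW.windowMass_nonneg hδ.le x)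
      calc L ^ (k + 1) ≤ (2 ^ s) ^ (k + 1) := by gcongr
        _ = (2 * 2 ^ k) ^ s := by rw [← pow_mul, mul_comm s, pow_mul, pow_succ']
        _ ≤ _ := by gcongr

theorem integral_le_windowMass (hW : IsPeriodicWeight W) (hd : IsDoublingPeriodic W L)
    (hL : 0 ≤ L) (hδ : 0 < δ) {k : ℕ} (hk : π ≤ 2 ^ k * δ) (x : ℝ) :
    ∫ θ in (-π)..π, W θ ≤ L ^ k * windowMass W δ x := by
  refine le_trans (le_of_eq ?_) (hW.windowMass_le_of_two_pow hd hL hδ pi_pos.le hk x)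
  have := hW.periodic.intervalIntegral_add_eq (x - π) (-π)
  rw [show -π + 2 * π = π by ring, show x - π + 2 * π = x + π by ring] at this
  exact this.symm

theorem exists_pos_forall_le_windowMass (hW : IsPeriodicWeight W) (hd : IsDoublingPeriodic W L)
    (hL : 0 < L) (hδ : 0 < δ) : ∃ m > 0, ∀ x, m ≤ windowMass W δ x := by
  obtain ⟨k, hk⟩ := pow_unbounded_of_one_lt (π / δ) one_lt_two
  refine ⟨(∫ θ in (-π)..π, W θ) / L ^ k, div_pos hW.integral_pos (by positivity), fun x => ?_⟩
  rw [div_le_iff₀' (by positivity)]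
  exact hW.integral_le_windowMass hd hL.le hδ ((div_le_iff₀ hδ).1 hk.le) x

/-- Averaging a weighted integral over windows of radius `η`. -/
theorem integral_windowMass_mul (hW : IsPeriodicWeight W) {g : ℝ → ℝ} (hg : Continuous g)
    (hp : Function.Periodic g (2 * π)) (η : ℝ) :
    ∫ x in (-π)..π, windowMass (fun θ => g θ * W θ) η x = 2 * η * ∫ θ in (-π)..π, g θ * W θ :=
  (hp.mul hW.periodic).integral_windowMass (hW.intervalIntegrable_mul hg) η

theorem continuous_windowMass_mul (hW : IsPeriodicWeight W) {g : ℝ → ℝ} (hg : Continuous g)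
    (η : ℝ) : Continuous (windowMass (fun θ => g θ * W θ) η) :=
  continuous_windowMass_of_intervalIntegrable (hW.intervalIntegrable_mul hg) η

theorem windowMass_mul_le (hW : IsPeriodicWeight W) {g : ℝ → ℝ} (hg : Continuous g)
    (hη : 0 ≤ η) {x c : ℝ} (h : ∀ θ, |θ - x| ≤ η → g θ ≤ c) :
    windowMass (fun θ => g θ * W θ) η x ≤ c * windowMass W η x := by
  rw [windowMass, windowMass, ← intervalIntegral.integral_const_mul]
  exact hW.integral_mul_mono hg continuous_const (by linarith)
    fun θ hθ => h θ (abs_le.2 ⟨by linarith [hθ.1], by linarith [hθ.2]⟩)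

theorem le_windowMass_mul (hW : IsPeriodicWeight W) {g : ℝ → ℝ} (hg : Continuous g)
    (hη : 0 ≤ η) {x c : ℝ} (h : ∀ θ, |θ - x| ≤ η → c ≤ g θ) :
    c * windowMass W η x ≤ windowMass (fun θ => g θ * W θ) η x := by
  rw [windowMass, windowMass, ← intervalIntegral.integral_const_mul]
  exact hW.integral_mul_mono continuous_const hg (by linarith)
    fun θ hθ => h θ (abs_le.2 ⟨by linarith [hθ.1], by linarith [hθ.2]⟩)

theorem integral_eq_centered (hW : IsPeriodicWeight W) {g : ℝ → ℝ}
    (hp : Function.Periodic g (2 * π)) (x : ℝ) :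
    ∫ θ in (-π)..π, g θ * W θ = ∫ θ in (x - π)..(x + π), g θ * W θ := by
  have := (hp.mul hW.periodic).intervalIntegral_add_eq (-π) (x - π)
  rwa [show -π + 2 * π = π by ring, show x - π + 2 * π = x + π by ring] at this

end IsPeriodicWeight

theorem abs_sin_half_periodic (x : ℝ) :
    Function.Periodic (fun θ : ℝ => |Real.sin ((θ - x) / 2)|) (2 * π) := fun θ => by
  have : (θ + 2 * π - x) / 2 = (θ - x) / 2 + π := by ring
  simp only [this, Real.sin_add_pi, abs_neg]

theorem abs_le_pi_mul_abs_sin_half {v : ℝ} (hv : |v| ≤ π) : |v| ≤ π * |Real.sin (v / 2)| := by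
  have h := Real.mul_abs_le_abs_sin (x := v / 2) (by rw [abs_div, abs_two]; linarith)
  rw [abs_div, abs_two] at h
  have := mul_le_mul_of_nonneg_left h pi_pos.le
  have e : π * (2 / π * (|v| / 2)) = |v| := by field_simp
  linarith

theorem integral_inv_one_add_mul_abs_sq_le {a : ℝ} (ha : 0 < a) (x : ℝ) :
    ∫ y in (x - π)..(x + π), ((1 + a * |y - x|) ^ 2)⁻¹ ≤ a⁻¹ * π := by
  have h₁ : ∫ y in (x - π)..(x + π), ((1 + a * |y - x|) ^ 2)⁻¹ ≤
      ∫ y in (x - π)..(x + π), (1 + (a * y - a * x) ^ 2)⁻¹ := by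
    have hpos : ∀ y, 0 < 1 + a * |y - x| := fun y => by positivity
    have hpos' : ∀ y, 0 < 1 + (a * y - a * x) ^ 2 := fun y => by positivity
    refine intervalIntegral.integral_mono_on (by linarith [pi_pos]) ?_ ?_ fun y _ => ?_
    · exact Continuous.intervalIntegrable
        (Continuous.inv₀ (by fun_prop) fun y => (pow_pos (hpos y) 2).ne') _ _
    · exact Continuous.intervalIntegrable (Continuous.inv₀ (by fun_prop) fun y => (hpos' y).ne') _ _
    · gcongr
      have : (a * y - a * x) ^ 2 = (a * |y - x|) ^ 2 := by
        rw [← mul_sub, mul_pow, mul_pow, sq_abs]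
      rw [this]
      nlinarith [mul_nonneg ha.le (abs_nonneg (y - x))]
  refine h₁.trans ?_
  rw [intervalIntegral.integral_comp_mul_sub (fun v => (1 + v ^ 2)⁻¹) ha.ne',
    integral_inv_one_add_sq,
    smul_eq_mul]
  gcongr
  linarith [Real.arctan_lt_pi_div_two (a * (x + π) - a * x),
    Real.neg_pi_div_two_lt_arctan (a * (x - π) - a * x)]

theorem IsPeriodicWeight.integral_decay_le {W : ℝ → ℝ} {L : ℝ} (hW : IsPeriodicWeight W)
    (hd : IsDoublingPeriodic W L) (hL : 0 ≤ L) {s : ℕ} (hs : L ≤ 2 ^ s) {n : ℕ} (hn : 1 ≤ n)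
    (x : ℝ) :
    ∫ θ in (-π)..π, ((1 + n * |Real.sin ((θ - x) / 2)|) ^ (s + 2))⁻¹ * W θ ≤
      (2 ^ (s + 2) * (2 * π) ^ s * π ^ 3) * windowMass W (1 / n) x := by
  have hn₀ : (0 : ℝ) < n := by exact_mod_cast hn
  set h : ℝ := 1 / n with hh
  have hpos : 0 < h := by positivity
  set σ : ℝ → ℝ := fun θ => 1 + n * |Real.sin ((θ - x) / 2)| with hσ
  have hσc : Continuous σ := by fun_prop
  have hσ1 : ∀ θ, 1 ≤ σ θ := fun θ => by
    have : (0 : ℝ) ≤ n * |Real.sin ((θ - x) / 2)| := by positivity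
    simp only [hσ]; linarith
  have hσ0 : ∀ θ, 0 < σ θ := fun θ => one_pos.trans_le (hσ1 θ)
  have hgc : Continuous fun θ => (σ θ ^ (s + 2))⁻¹ :=
    (hσc.pow _).inv₀ fun θ => (pow_pos (hσ0 θ) _).ne'
  have hgp : Function.Periodic (fun θ => (σ θ ^ (s + 2))⁻¹) (2 * π) := fun θ => by
    have := abs_sin_half_periodic x θ
    simp only at this
    simp only [hσ, this]
  have hM := hW.windowMass_nonneg hpos.le x
  have hwin : ∀ y, windowMass (fun θ => (σ θ ^ (s + 2))⁻¹ * W θ) h y ≤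
      2 ^ (s + 2) * (σ y ^ (s + 2))⁻¹ * windowMass W h y := fun y => by
    refine hW.windowMass_mul_le hgc hpos.le fun θ hθ => ?_
    have h₁ : σ y ≤ 2 * σ θ := by
      have h₂ : |Real.sin ((y - x) / 2)| - |Real.sin ((θ - x) / 2)| ≤ |θ - y| / 2 := by
        refine (abs_sub_abs_le_abs_sub _ _).trans ((Real.abs_sin_sub_sin_le _ _).trans ?_)
        rw [← abs_sub_comm y θ, ← sub_div, abs_div, abs_two, sub_sub_sub_cancel_right]
      have h₃ : n * |θ - y| ≤ 1 := by
        rwa [hh, le_div_iff₀' hn₀] at hθ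
      have := hσ1 θ
      simp only [hσ] at this ⊢
      nlinarith
    rw [← div_eq_mul_inv, inv_eq_one_div, div_le_div_iff₀ (pow_pos (hσ0 θ) _) (pow_pos (hσ0 y) _),
      one_mul, ← mul_pow]
    exact pow_le_pow_left₀ (hσ0 y).le h₁ _
  have hMc := hW.continuous_windowMass h
  have hint : ∫ y in (-π)..π, windowMass (fun θ => (σ θ ^ (s + 2))⁻¹ * W θ) h y ≤
      ∫ y in (-π)..π, 2 ^ (s + 2) * (σ y ^ (s + 2))⁻¹ * windowMass W h y :=
    intervalIntegral.integral_mono_on (by linarith [pi_pos])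
      ((hW.continuous_windowMass_mul hgc h).intervalIntegrable _ _)
      (((continuous_const.mul hgc).mul hMc).intervalIntegrable _ _) fun y _ => hwin y
  have hshift : ∫ y in (-π)..π, 2 ^ (s + 2) * (σ y ^ (s + 2))⁻¹ * windowMass W h y =
      ∫ y in (x - π)..(x + π), 2 ^ (s + 2) * (σ y ^ (s + 2))⁻¹ * windowMass W h y := by
    have hp : Function.Periodic (fun y => 2 ^ (s + 2) * (σ y ^ (s + 2))⁻¹ * windowMass W h y)
        (2 * π) := fun y => by
      have := hgp y
      simp only at this
      simp only [this, hW.periodic_windowMass h y]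
    have := hp.intervalIntegral_add_eq (-π) (x - π)
    rwa [show -π + 2 * π = π by ring, show x - π + 2 * π = x + π by ring] at this
  have hlast : ∫ y in (x - π)..(x + π), 2 ^ (s + 2) * (σ y ^ (s + 2))⁻¹ * windowMass W h y ≤
      ∫ y in (x - π)..(x + π),
        (2 ^ (s + 2) * (2 * π) ^ s * π ^ 2 * windowMass W h x) * ((1 + n * |y - x|) ^ 2)⁻¹ := by
    have hpos' : ∀ y, 0 < 1 + (n : ℝ) * |y - x| := fun y => by positivity
    refine intervalIntegral.integral_mono_on (by linarith [pi_pos])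
      (((continuous_const.mul hgc).mul hMc).intervalIntegrable _ _)
      (Continuous.intervalIntegrable (continuous_const.mul
        (Continuous.inv₀ (by fun_prop) fun y => (pow_pos (hpos' y) 2).ne')) _ _) fun y hy => ?_
    have hyx : |y - x| ≤ π := abs_le.2 ⟨by linarith [hy.1], by linarith [hy.2]⟩
    have h₁ : 1 + n * |y - x| ≤ π * σ y := by
      have := mul_le_mul_of_nonneg_left (abs_le_pi_mul_abs_sin_half hyx) hn₀.le
      simp only [hσ]
      nlinarith [pi_gt_three]
    have h₂ : windowMass W h y ≤ (2 * (π * σ y)) ^ s * windowMass W h x := by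
      refine (hW.windowMass_growth hd hL hs hpos x y).trans ?_
      rw [hh, abs_sub_comm, div_div_eq_mul_div, div_one, mul_comm _ (n : ℝ), ← hh]
      gcongr
    have h₃ : (π ^ 2)⁻¹ * (σ y ^ 2)⁻¹ ≤ ((1 + n * |y - x|) ^ 2)⁻¹ := by
      rw [← mul_inv, ← mul_pow]
      exact inv_anti₀ (pow_pos (hpos' y) 2) (pow_le_pow_left₀ (hpos' y).le h₁ 2)
    have hσy := hσ0 y
    calc 2 ^ (s + 2) * (σ y ^ (s + 2))⁻¹ * windowMass W h y
        ≤ 2 ^ (s + 2) * (σ y ^ (s + 2))⁻¹ * ((2 * (π * σ y)) ^ s * windowMass W h x) := by gcongr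
      _ = (2 ^ (s + 2) * (2 * π) ^ s * π ^ 2 * windowMass W h x) * ((π ^ 2)⁻¹ * (σ y ^ 2)⁻¹) := by
        field_simp
        rw [mul_pow (2 * π)]
        ring
      _ ≤ _ := by gcongr
  rw [intervalIntegral.integral_const_mul] at hlast
  have htail := integral_inv_one_add_mul_abs_sq_le hn₀ x
  rw [hW.integral_windowMass_mul hgc hgp, hshift] at hint
  have hfin := hint.trans (hlast.trans (mul_le_mul_of_nonneg_left htail (by positivity)))
  have hC : 0 ≤ 2 ^ (s + 2) * (2 * π) ^ s * π ^ 3 * windowMass W h x := by positivity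
  have : h * (2 * ∫ θ in (-π)..π, (σ θ ^ (s + 2))⁻¹ * W θ) ≤
      h * (2 ^ (s + 2) * (2 * π) ^ s * π ^ 3 * windowMass W h x) := by
    refine le_trans (le_of_eq ?_) (hfin.trans (le_of_eq ?_))
    · ring
    · rw [hh, one_div]; ring
  have := le_of_mul_le_mul_left this hpos
  linarith

/-- The Dirichlet kernel of degree `l`, normalized to have value `1` at `0`. -/
def dirichletMean (l : ℕ) (y : ℝ) : ℝ :=
  (2 * (l : ℝ) + 1)⁻¹ * (1 + 2 * ∑ j ∈ Finset.range l, Real.cos ((j + 1 : ℕ) * y))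

theorem isTrigPoly_dirichletMean (l : ℕ) : IsTrigPoly l (dirichletMean l) :=
  ((IsTrigPoly.const l 1).add ((IsTrigPoly.sum (Finset.range l) fun _ hj =>
    IsTrigPoly.cos_nat (Finset.mem_range.1 hj)).const_mul 2)).const_mul _

theorem abs_dirichletMean_le_one (l : ℕ) (y : ℝ) : |dirichletMean l y| ≤ 1 := by
  have hpos : (0 : ℝ) < 2 * l + 1 := by positivity
  rw [dirichletMean, abs_mul, abs_of_pos (inv_pos.2 hpos), inv_mul_le_iff₀ hpos, mul_one]
  have h : |∑ j ∈ Finset.range l, Real.cos ((j + 1 : ℕ) * y)| ≤ l := by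
    refine (Finset.abs_sum_le_sum_abs _ _).trans ?_
    simpa using Finset.sum_le_card_nsmul (Finset.range l) _ 1 fun j _ =>
      Real.abs_cos_le_one ((j + 1 : ℕ) * y)
  have := abs_le.1 h
  exact abs_le.2 ⟨by linarith, by linarith⟩

theorem sin_half_mul_dirichletMean (l : ℕ) (y : ℝ) :
    (2 * l + 1) * (Real.sin (y / 2) * dirichletMean l y) = Real.sin (l * y + y / 2) := by
  have hpos : (2 * (l : ℝ) + 1) ≠ 0 := by positivity
  rw [dirichletMean, mul_left_comm (Real.sin _), mul_inv_cancel_left₀ hpos]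
  clear hpos
  induction l with
  | zero => simp
  | succ l ih =>
    have e₁ : (l : ℝ) * y + y / 2 = (l + 1 : ℕ) * y - y / 2 := by push_cast; ring
    rw [Finset.sum_range_succ, mul_add 2, ← add_assoc, mul_add, ih, e₁, Real.sin_sub, Real.sin_add]
    ring

theorem half_le_dirichletMean {l : ℕ} {y : ℝ} (h : l * |y| ≤ 1) : 1 / 2 ≤ dirichletMean l y := by
  have hpos : (0 : ℝ) < 2 * l + 1 := by positivity
  rw [dirichletMean, le_inv_mul_iff₀ hpos]
  have h' : (l : ℝ) * (1 / 2) ≤ ∑ j ∈ Finset.range l, Real.cos ((j + 1 : ℕ) * y) := by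
    have := Finset.card_nsmul_le_sum (Finset.range l) (fun j => Real.cos ((j + 1 : ℕ) * y)) (1 / 2)
      fun j hj => by
        have hjl : ((j + 1 : ℕ) : ℝ) ≤ l := by exact_mod_cast Finset.mem_range.1 hj
        have h₁ : |((j + 1 : ℕ) : ℝ) * y| ≤ 1 := by
          rw [abs_mul, abs_of_nonneg (by positivity)]
          exact (mul_le_mul_of_nonneg_right hjl (abs_nonneg y)).trans h
        have h₂ := Real.one_sub_sq_div_two_le_cos (x := ((j + 1 : ℕ) : ℝ) * y)
        have h₃ := (sq_le_one_iff_abs_le_one _).2 h₁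
        linarith
    simpa using this
  linarith

/-- A nonnegative trigonometric polynomial of degree less than `n` that is concentrated near `0`
at scale `1 / n`. -/
def peakKernel (m n : ℕ) (y : ℝ) : ℝ := dirichletMean ((n - 1) / (2 * m)) y ^ (2 * m)

theorem isTrigPoly_peakKernel (m n : ℕ) : IsTrigPoly (n - 1) (peakKernel m n) :=
  ((isTrigPoly_dirichletMean _).pow _).mono (Nat.mul_div_le _ _)

theorem peakKernel_nonneg (m n : ℕ) (y : ℝ) : 0 ≤ peakKernel m n y := by
  rw [peakKernel, pow_mul]
  positivity

theorem le_peakKernel {m n : ℕ} {y : ℝ} (h : n * |y| ≤ 1) :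
    (1 / 2) ^ (2 * m) ≤ peakKernel m n y := by
  refine pow_le_pow_left₀ (by norm_num) (half_le_dirichletMean (le_trans ?_ h)) _
  gcongr
  exact (Nat.div_le_self _ _).trans (Nat.sub_le _ _)

theorem peakKernel_zero (m n : ℕ) : peakKernel m n 0 = 1 := by
  have : (2 * (((n - 1) / (2 * m) : ℕ) : ℝ) + 1) ≠ 0 := by positivity
  simp only [peakKernel, dirichletMean, mul_zero, Real.cos_zero, Finset.sum_const,
    Finset.card_range, nsmul_eq_mul, mul_one]
  rw [add_comm (1 : ℝ), inv_mul_cancel₀ this, one_pow]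

theorem peakKernel_le {m n : ℕ} (hm : 1 ≤ m) (y : ℝ) :
    peakKernel m n y ≤ (1 + 2 * m) ^ (2 * m) * ((1 + n * |Real.sin (y / 2)|) ^ (2 * m))⁻¹ := by
  set l := (n - 1) / (2 * m) with hl
  have hσ : 0 < 1 + n * |Real.sin (y / 2)| := by positivity
  have hnl : (n : ℝ) ≤ 2 * m * (2 * l + 1) := by
    have h₁ : n ≤ 2 * m * (2 * l + 1) := by
      have := Nat.lt_mul_div_succ (n - 1) (show 0 < 2 * m by omega)
      have : n ≤ 2 * m * (l + 1) := by rw [← hl] at this; omega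
      exact this.trans (Nat.mul_le_mul_left _ (by omega))
    exact_mod_cast h₁
  have hD := abs_dirichletMean_le_one l y
  have h₂ : (2 * l + 1) * (|Real.sin (y / 2)| * |dirichletMean l y|) ≤ 1 := by
    have := Real.abs_sin_le_one (l * y + y / 2)
    rwa [← sin_half_mul_dirichletMean, abs_mul, abs_mul,
      abs_of_pos (show (0 : ℝ) < 2 * l + 1 by positivity)] at this
  have h₃ : |dirichletMean l y| * (1 + n * |Real.sin (y / 2)|) ≤ 1 + 2 * m := by
    have h₄ := mul_le_mul_of_nonneg_right hnl
      (mul_nonneg (abs_nonneg (Real.sin (y / 2))) (abs_nonneg (dirichletMean l y)))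
    have h₅ := mul_le_mul_of_nonneg_left h₂ (show (0 : ℝ) ≤ 2 * m by positivity)
    linarith
  rw [← div_eq_mul_inv, le_div_iff₀ (pow_pos hσ _), peakKernel, ← hl,
    ← Even.pow_abs (even_two_mul m), ← mul_pow]
  exact pow_le_pow_left₀ (by positivity) h₃ _

theorem IsTrigPoly.sub_sq_sin_half {n : ℕ} (hn : 1 ≤ n) {p : ℝ → ℝ} (hp : IsTrigPoly (n - 1) p)
    (b c : ℝ) : IsTrigPoly n fun y => p y * (b - c * Real.sin (y / 2) ^ 2) := by
  have h := hp.mul (((IsTrigPoly.cos_nat (n := 1) le_rfl).const_mul (c / 2)).add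
    (IsTrigPoly.const 1 (b - c / 2)))
  rw [Nat.sub_add_cancel hn] at h
  convert h using 3 with y
  have : Real.cos y = 1 - 2 * Real.sin (y / 2) ^ 2 := by
    rw [Real.sin_sq_eq_half_sub, mul_div_cancel₀ y two_ne_zero]
    ring
  rw [Nat.cast_one, one_mul, this]
  ring

theorem IsTrigChebQuad.pos {W : ℝ → ℝ} (hW : IsPeriodicWeight W) {n N : ℕ} {θs : Fin N → ℝ}
    (h : IsTrigChebQuad W n N θs) : 0 < N := by
  refine Nat.pos_of_ne_zero fun h0 => ?_
  subst h0
  have := h.2 _ (IsTrigPoly.const n 1)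
  simp only [one_mul, Finset.univ_eq_empty, Finset.sum_empty, mul_zero] at this
  exact hW.integral_pos.ne' this

/-- Every window of radius `1 / n` carries a fixed proportion of the weight of a node. -/
theorem exists_weight_le_windowMass {L : ℝ} (hL : 0 ≤ L) :
    ∃ C > 0, ∀ W : ℝ → ℝ, IsPeriodicWeight W → IsDoublingPeriodic W L → ∀ n : ℕ, 1 ≤ n →
      ∀ N : ℕ, ∀ θs : Fin N → ℝ, IsTrigChebQuad W n N θs → ∀ x,
        (∫ θ in (-π)..π, W θ) / N ≤ C * windowMass W (1 / n) x := by
  obtain ⟨s, hs⟩ := pow_unbounded_of_one_lt L one_lt_two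
  set m := s + 2 with hm
  have hm1 : 1 ≤ m := by omega
  set C₁ : ℝ := 2 ^ (s + 2) * (2 * π) ^ s * π ^ 3 with hC₁
  have hC₁pos : 0 < C₁ := by positivity
  set C₂ : ℝ := (1 + 2 * m) ^ (2 * m) * C₁ with hC₂
  have hC₂pos : 0 < C₂ := by positivity
  set b : ℝ := 2 ^ (2 * m) * C₂ + 1 with hb
  have hb1 : 1 ≤ b := by
    have : 0 < 2 ^ (2 * m) * C₂ := by positivity
    linarith
  refine ⟨C₂ * (2 * (1 + π * b)) ^ s, by positivity, fun W hW hd n hn N θs hq x => ?_⟩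
  have hn₀ : (0 : ℝ) < n := by exact_mod_cast hn
  have hn₁ : (1 : ℝ) ≤ n := by exact_mod_cast hn
  have hN := hq.pos hW
  have hT := hW.integral_pos
  have hwt : 0 < (∫ θ in (-π)..π, W θ) / N := div_pos hT (by exact_mod_cast hN)
  have hpos : (0 : ℝ) < 1 / n := by positivity
  have hdecay := fun x => hW.integral_decay_le hd hL hs.le hn x
  rw [← hC₁] at hdecay
  have hKc : ∀ x, Continuous fun θ => peakKernel m n (θ - x) := fun x =>
    ((isTrigPoly_peakKernel m n).comp_sub x).continuous
  have hσ1 : ∀ x θ : ℝ, 1 ≤ 1 + n * |Real.sin ((θ - x) / 2)| := fun x θ => by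
    have : (0 : ℝ) ≤ n * |Real.sin ((θ - x) / 2)| := by positivity
    linarith
  have hgc : ∀ x, Continuous fun θ : ℝ => ((1 + n * |Real.sin ((θ - x) / 2)|) ^ (s + 2))⁻¹ :=
    fun x => Continuous.inv₀ (by fun_prop) fun θ => (pow_pos (one_pos.trans_le (hσ1 x θ)) _).ne'
  have hππ : (-π : ℝ) ≤ π := by linarith [pi_pos]
  have hbound : ∀ x, ∀ g : ℝ → ℝ, Continuous g → (∀ θ, g θ ≤
      (1 + 2 * m) ^ (2 * m) * ((1 + n * |Real.sin ((θ - x) / 2)|) ^ (s + 2))⁻¹) →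
      ∫ θ in (-π)..π, g θ * W θ ≤ C₂ * windowMass W (1 / n) x := by
    intro x g hg hle
    have hc : Continuous fun θ : ℝ =>
        (1 + 2 * (m : ℝ)) ^ (2 * m) * ((1 + n * |Real.sin ((θ - x) / 2)|) ^ (s + 2))⁻¹ :=
      continuous_const.mul (hgc x)
    refine (hW.integral_mul_mono hg hc hππ fun θ _ => hle θ).trans ?_
    simp only [mul_assoc, intervalIntegral.integral_const_mul]
    refine ((mul_le_mul_of_nonneg_left (hdecay x) (by positivity)).trans (le_of_eq ?_))
    rw [hC₂]
    ring
  have hK₁ : ∀ x, ∫ θ in (-π)..π, peakKernel m n (θ - x) * W θ ≤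
      C₂ * windowMass W (1 / n) x := fun x => by
    refine hbound x _ (hKc x) fun θ => (peakKernel_le hm1 _).trans ?_
    gcongr
    · exact hσ1 x θ
    · omega
  have hK₂ : ∀ x, ∫ θ in (-π)..π,
      (peakKernel m n (θ - x) * (n ^ 2 * Real.sin ((θ - x) / 2) ^ 2)) * W θ ≤
      C₂ * windowMass W (1 / n) x := fun x => by
    refine hbound x _ ((hKc x).mul (by fun_prop)) fun θ => ?_
    have h₁ := hσ1 x θ
    set σ := 1 + n * |Real.sin ((θ - x) / 2)| with hσ
    have h₀ : 0 < σ := one_pos.trans_le h₁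
    have h₂ : (n : ℝ) ^ 2 * Real.sin ((θ - x) / 2) ^ 2 ≤ σ ^ 2 := by
      rw [← sq_abs (Real.sin _), ← mul_pow]
      exact pow_le_pow_left₀ (by positivity) (by linarith) 2
    calc peakKernel m n (θ - x) * (n ^ 2 * Real.sin ((θ - x) / 2) ^ 2)
        ≤ ((1 + 2 * m) ^ (2 * m) * (σ ^ (2 * m))⁻¹) * σ ^ 2 :=
          mul_le_mul (peakKernel_le hm1 _) h₂ (by positivity) (by positivity)
      _ = (1 + 2 * m) ^ (2 * m) * (σ ^ (2 * s + 2))⁻¹ := by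
        rw [show 2 * m = 2 * s + 2 + 2 by omega, pow_add σ (2 * s + 2) 2]
        field_simp
      _ ≤ _ := by
        refine mul_le_mul_of_nonneg_left (inv_anti₀ (pow_pos h₀ _) ?_) (by positivity)
        exact pow_le_pow_right₀ h₁ (by omega)
  have hnode : ∀ i, (∫ θ in (-π)..π, W θ) / N ≤ C₂ * windowMass W (1 / n) (θs i) := fun i => by
    refine le_trans ?_ (hK₁ (θs i))
    rw [hq.2 _ (((isTrigPoly_peakKernel m n).mono (Nat.sub_le n 1)).comp_sub (θs i))]
    refine le_mul_of_one_le_right hwt.le ?_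
    have := Finset.single_le_sum (fun j _ => peakKernel_nonneg m n (θs j - θs i))
      (Finset.mem_univ i)
    rwa [sub_self, peakKernel_zero] at this
  have hM : 0 < windowMass W (1 / n) x := by
    let i : Fin N := ⟨0, hN⟩
    have h₁ := hW.windowMass_growth hd hL hs.le hpos x (θs i)
    have h₂ : 0 < windowMass W (1 / n) (θs i) :=
      pos_of_mul_pos_right (hwt.trans_le (hnode i)) hC₂pos.le
    exact pos_of_mul_pos_right (h₂.trans_le h₁) (by positivity)
  have hnear : ∃ i, n * |Real.sin ((θs i - x) / 2)| < b := by
    have hp := (IsTrigPoly.sub_sq_sin_half hn (isTrigPoly_peakKernel m n) (b ^ 2)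
      (n ^ 2)).comp_sub x
    have hlow : (1 / 2) ^ (2 * m) * windowMass W (1 / n) x ≤
        ∫ θ in (-π)..π, peakKernel m n (θ - x) * W θ := by
      have hper : Function.Periodic (fun θ => peakKernel m n (θ - x)) (2 * π) :=
        ((isTrigPoly_peakKernel m n).comp_sub x).periodic
      rw [hW.integral_eq_centered hper x]
      refine (hW.le_windowMass_mul (hKc x) hpos.le fun θ hθ => ?_).trans ?_
      · refine le_peakKernel ?_
        rwa [le_div_iff₀' hn₀] at hθ
      · have h1 : (1 : ℝ) / n ≤ π := by
          rw [div_le_iff₀ hn₀]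
          nlinarith [pi_gt_three]
        exact intervalIntegral.integral_mono_interval (by linarith) (by linarith) (by linarith)
          (Filter.Eventually.of_forall fun θ => mul_nonneg (peakKernel_nonneg _ _ _) (hW.nonneg θ))
          (hW.intervalIntegrable_mul (hKc x) _ _)
    have hint : 0 < ∫ θ in (-π)..π,
        (peakKernel m n (θ - x) * (b ^ 2 - n ^ 2 * Real.sin ((θ - x) / 2) ^ 2)) * W θ := by
      have hsplit : ∫ θ in (-π)..π,
          (peakKernel m n (θ - x) * (b ^ 2 - n ^ 2 * Real.sin ((θ - x) / 2) ^ 2)) * W θ =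
          b ^ 2 * (∫ θ in (-π)..π, peakKernel m n (θ - x) * W θ) -
          ∫ θ in (-π)..π,
            (peakKernel m n (θ - x) * (n ^ 2 * Real.sin ((θ - x) / 2) ^ 2)) * W θ := by
        rw [← intervalIntegral.integral_const_mul, ← intervalIntegral.integral_sub]
        · congr 1
          ext θ
          ring
        · exact (hW.intervalIntegrable_mul (hKc x) _ _).const_mul _
        · exact hW.intervalIntegrable_mul ((hKc x).mul (by fun_prop)) _ _
      rw [hsplit]
      have h₁ := mul_le_mul_of_nonneg_left hlow (show 0 ≤ b ^ 2 by positivity)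
      have h₂ : C₂ < b ^ 2 * (1 / 2) ^ (2 * m) := by
        have h₃ : b * (1 / 2) ^ (2 * m) = C₂ + (1 / 2) ^ (2 * m) := by
          rw [hb, add_mul, mul_right_comm, ← mul_pow]
          norm_num
        have h₄ : (0 : ℝ) < (1 / 2) ^ (2 * m) := by positivity
        nlinarith
      have h₃ := mul_lt_mul_of_pos_right h₂ hM
      linarith [hK₂ x]
    rw [hq.2 _ hp] at hint
    obtain ⟨i, -, hi⟩ := Finset.exists_lt_of_sum_lt (s := Finset.univ) (f := fun _ => (0 : ℝ))
      (by simpa using pos_of_mul_pos_right hint hwt.le)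
    refine ⟨i, ?_⟩
    have := pos_of_mul_pos_right hi (peakKernel_nonneg _ _ _)
    refine lt_of_pow_lt_pow_left₀ 2 (by linarith) ?_
    rw [mul_pow, sq_abs]
    linarith
  obtain ⟨i, hi⟩ := hnear
  set z := toIocDiv two_pi_pos (x - π) (θs i) with hz
  set θ' := toIocMod two_pi_pos (x - π) (θs i) with hθ'
  have hmem := toIocMod_mem_Ioc two_pi_pos (x - π) (θs i)
  have hθ'eq : θ' = θs i - z • (2 * π) := rfl
  have hsin : |Real.sin ((θ' - x) / 2)| = |Real.sin ((θs i - x) / 2)| := by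
    rw [hθ'eq]
    exact (abs_sin_half_periodic x).sub_zsmul_eq z
  have hmass : windowMass W (1 / n) θ' = windowMass W (1 / n) (θs i) := by
    rw [hθ'eq]
    exact (hW.periodic_windowMass _).sub_zsmul_eq z
  have hdist : |x - θ'| / (1 / n) ≤ π * b := by
    have h₁ : |θ' - x| ≤ π := abs_le.2 ⟨by linarith [hmem.1], by linarith [hmem.2]⟩
    have h₂ := abs_le_pi_mul_abs_sin_half h₁
    rw [hsin] at h₂
    rw [abs_sub_comm, div_div_eq_mul_div, div_one]
    nlinarith [pi_pos]
  calc (∫ θ in (-π)..π, W θ) / N ≤ C₂ * windowMass W (1 / n) (θs i) := hnode i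
    _ ≤ C₂ * ((2 * (1 + π * b)) ^ s * windowMass W (1 / n) x) := by
      rw [← hmass]
      refine mul_le_mul_of_nonneg_left ?_ hC₂pos.le
      refine (hW.windowMass_growth hd hL hs.le hpos x θ').trans ?_
      gcongr
    _ = _ := by ring

theorem IsPeriodicWeight.integral_div_le_windowMass {W : ℝ → ℝ} {L : ℝ} (hW : IsPeriodicWeight W)
    (hd : IsDoublingPeriodic W L) (hL : 0 < L) {n : ℕ} (hn : 1 ≤ n) :
    0 < Rtrig W n ∧ ∀ x, (∫ θ in (-π)..π, W θ) / Rtrig W n ≤ windowMass W (1 / n) x := by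
  obtain ⟨m, hm, hle⟩ := hW.exists_pos_forall_le_windowMass hd hL
    (δ := 1 / n) (by have : (0 : ℝ) < n := by exact_mod_cast hn
                     positivity)
  have hinf : 0 < sInf (Set.range fun x : ℝ => ∫ θ in (x - 1/n)..(x + 1/n), W θ) :=
    hm.trans_le (le_csInf (range_nonempty _) (by rintro _ ⟨x, rfl⟩; exact hle x))
  refine ⟨div_pos hW.integral_pos hinf, fun x => ?_⟩
  rw [Rtrig, div_div_cancel₀ hW.integral_pos.ne']
  exact csInf_le ⟨m, by rintro _ ⟨x, rfl⟩; exact hle x⟩ ⟨x, rfl⟩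

theorem exists_mul_Rtrig_le_card {L : ℝ} (hL : 0 ≤ L) :
    ∃ c > 0, ∀ W : ℝ → ℝ, IsPeriodicWeight W → IsDoublingPeriodic W L → ∀ n : ℕ, 1 ≤ n →
      ∀ N : ℕ, ∀ θs : Fin N → ℝ, IsTrigChebQuad W n N θs → c * Rtrig W n ≤ N := by
  obtain ⟨C, hC, h⟩ := exists_weight_le_windowMass hL
  refine ⟨C⁻¹, inv_pos.2 hC, fun W hW hd n hn N θs hq => ?_⟩
  have hN : (0 : ℝ) < N := by exact_mod_cast hq.pos hW
  have hT := hW.integral_pos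
  have hinf : (∫ θ in (-π)..π, W θ) / N / C ≤
      sInf (Set.range fun x : ℝ => ∫ θ in (x - 1/n)..(x + 1/n), W θ) :=
    le_csInf (range_nonempty _) (by
      rintro _ ⟨x, rfl⟩
      rw [div_le_iff₀' hC]
      exact h W hW hd n hn N θs hq x)
  rw [inv_mul_le_iff₀ hC, Rtrig]
  refine (div_le_div_of_nonneg_left hT.le (by positivity) hinf).trans (le_of_eq ?_)
  field_simp

open FourierTransform SchwartzMap in
/-- A Schwartz function whose Fourier transform is identically `1` on `[-1, 1]`. -/
theorem exists_schwartzMap_fourier_eq_one :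
    ∃ φ : SchwartzMap ℝ ℂ, ∀ ξ : ℝ, |ξ| ≤ 1 → 𝓕 (φ : ℝ → ℂ) ξ = 1 := by
  let b : ContDiffBump (0 : ℝ) := ⟨1, 2, one_pos, one_lt_two⟩
  have hc : HasCompactSupport (Complex.ofReal ∘ b) :=
    b.hasCompactSupport.comp_left Complex.ofReal_zero
  have hs : ContDiff ℝ (⊤ : ℕ∞) (Complex.ofReal ∘ b) :=
    Complex.ofRealCLM.contDiff.comp b.contDiff
  refine ⟨𝓕⁻ (hc.toSchwartzMap hs), fun ξ hξ => ?_⟩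
  rw [← SchwartzMap.fourier_coe, FourierInvPair.fourier_fourierInv_eq,
    HasCompactSupport.toSchwartzMap_toFun, Function.comp_apply,
    b.one_of_mem_closedBall (by simpa [b] using hξ), Complex.ofReal_one]

open FourierTransform in
/-- Averaging translates of a harmonic against an integrable function. -/
theorem integral_cos_mul_eq_fourier {f : ℝ → ℂ} (hf : Integrable f) (k x c h : ℝ) :
    ∫ v : ℝ, ((Real.cos (k * (x - v * h) + c) : ℝ) : ℂ) * f v =
      (Complex.exp ((k * x + c : ℝ) * Complex.I) * 𝓕 f (k * h / (2 * π)) +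
        Complex.exp (-(k * x + c : ℝ) * Complex.I) * 𝓕 f (-(k * h / (2 * π)))) / 2 := by
  have hint : ∀ a b : ℝ, Integrable fun v : ℝ =>
      Complex.exp ((b : ℂ) * Complex.I) * (Complex.exp ((a * v : ℝ) * Complex.I) * f v) :=
    fun a b => (hf.bdd_mul (c := 1) (by fun_prop)
      (Filter.Eventually.of_forall fun v => (Complex.norm_exp_ofReal_mul_I _).le)).const_mul _
  have hF : ∀ a b : ℝ, Complex.exp ((b : ℂ) * Complex.I) * 𝓕 f a =
      ∫ v : ℝ, Complex.exp ((b : ℂ) * Complex.I) *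
        (Complex.exp (((-2 * π * a) * v : ℝ) * Complex.I) * f v) := fun a b => by
    rw [Real.fourier_real_eq_integral_exp_smul, ← integral_const_mul]
    refine integral_congr_ae (Filter.Eventually.of_forall fun v => ?_)
    simp only [smul_eq_mul]
    congr 4
    push_cast
    ring
  have hneg : (-((k * x + c : ℝ) : ℂ)) = ((-(k * x + c) : ℝ) : ℂ) := by push_cast; ring
  rw [hneg, hF, hF, ← integral_add (hint _ _) (hint _ _), ← integral_div]
  refine integral_congr_ae (Filter.Eventually.of_forall fun v => ?_)
  simp only
  rw [← mul_assoc, ← mul_assoc, ← Complex.exp_add, ← Complex.exp_add, Complex.ofReal_cos,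
    Complex.cos, ← add_mul, div_mul_eq_mul_div]
  have hπ : (π : ℂ) ≠ 0 := by exact_mod_cast pi_ne_zero
  congr 5
  · push_cast
    field_simp
    ring
  · push_cast
    field_simp
    ring

theorem IsTrigPoly.integrable_comp_mul {n : ℕ} {q : ℝ → ℝ} (hq : IsTrigPoly n q) {f : ℝ → ℂ}
    (hf : Integrable f) (x h : ℝ) :
    Integrable fun v : ℝ => ((q (x - v * h) : ℝ) : ℂ) * f v := by
  obtain ⟨B, hB⟩ := hq.exists_bound
  have hc := hq.continuous
  refine hf.bdd_mul (c := B) (by fun_prop) (Filter.Eventually.of_forall fun v => ?_)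
  simpa using hB _

open FourierTransform in
/-- A trigonometric polynomial of degree `n` is reproduced by averaging its translates at scale
`1 / n`, and so is its derivative. -/
theorem IsTrigPoly.reproducing {φ : SchwartzMap ℝ ℂ}
    (hφ : ∀ ξ : ℝ, |ξ| ≤ 1 → 𝓕 (φ : ℝ → ℂ) ξ = 1) {n : ℕ} (hn : 1 ≤ n) {q : ℝ → ℝ}
    (hq : IsTrigPoly n q) (x : ℝ) :
    ∫ v : ℝ, ((q (x - v * (1 / n)) : ℝ) : ℂ) * φ v = q x ∧
    ∫ v : ℝ, ((q (x - v * (1 / n)) : ℝ) : ℂ) * SchwartzMap.derivCLM ℂ ℂ φ v =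
      (_root_.deriv q x / n : ℝ) := by
  set ψ := SchwartzMap.derivCLM ℂ ℂ φ with hψ
  have hn₀ : (0 : ℝ) < n := by exact_mod_cast hn
  have hψF : ∀ ξ : ℝ, |ξ| ≤ 1 → 𝓕 (ψ : ℝ → ℂ) ξ = 2 * π * Complex.I * ξ := fun ξ hξ => by
    have h₁ : (ψ : ℝ → ℂ) = _root_.deriv φ := funext fun x => SchwartzMap.derivCLM_apply ℂ φ x
    have h₂ := ψ.integrable (μ := volume)
    rw [h₁] at h₂ ⊢
    rw [Real.fourier_deriv φ.integrable φ.differentiable h₂]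
    simp only [hφ ξ hξ, smul_eq_mul, mul_one]
  refine (hq.induction (motive := fun q => IsTrigPoly n q ∧ ∀ x,
    ∫ v : ℝ, ((q (x - v * (1 / n)) : ℝ) : ℂ) * φ v = q x ∧
    ∫ v : ℝ, ((q (x - v * (1 / n)) : ℝ) : ℂ) * ψ v = (_root_.deriv q x / n : ℝ)) ?_ ?_ ?_).2 x
  · intro k hk c
    refine ⟨by simpa using IsTrigPoly.cos_add (n := n) (k := k) (by simpa using hk) c, fun x => ?_⟩
    have hξ : |(k : ℝ) * (1 / n) / (2 * π)| ≤ 1 := by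
      have h₁ : (k : ℝ) * (1 / n) ≤ 1 := by
        rw [mul_one_div, div_le_one hn₀]
        exact_mod_cast hk
      rw [abs_of_nonneg (by positivity), div_le_one (by positivity)]
      linarith [pi_gt_three]
    have hξ' : |-((k : ℝ) * (1 / n) / (2 * π))| ≤ 1 := by rwa [abs_neg]
    have hd : _root_.deriv (fun θ : ℝ => Real.cos (k * θ + c)) x = -(k * Real.sin (k * x + c)) := by
      have h₁ : HasDerivAt (fun θ : ℝ => (k : ℝ) * θ + c) k x := by
        simpa using ((hasDerivAt_id x).const_mul (k : ℝ)).add_const c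
      rw [h₁.cos.deriv]
      ring
    constructor
    · rw [integral_cos_mul_eq_fourier φ.integrable, hφ _ hξ, hφ _ hξ', Complex.ofReal_cos,
        Complex.cos, mul_one, mul_one]
    · have hπ : (π : ℂ) ≠ 0 := by exact_mod_cast pi_ne_zero
      have hn' : (n : ℂ) ≠ 0 := by exact_mod_cast hn₀.ne'
      rw [integral_cos_mul_eq_fourier ψ.integrable, hψF _ hξ, hψF _ hξ', hd]
      push_cast
      rw [Complex.sin]
      field_simp
      ring
  · rintro p q ⟨hp, hp'⟩ ⟨hq, hq'⟩
    refine ⟨hp.add hq, fun x => ⟨?_, ?_⟩⟩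
    · simp only [Complex.ofReal_add, add_mul]
      rw [integral_add (hp.integrable_comp_mul φ.integrable x _)
        (hq.integrable_comp_mul φ.integrable x _), (hp' x).1, (hq' x).1]
    · simp only [Complex.ofReal_add, add_mul]
      rw [integral_add (hp.integrable_comp_mul ψ.integrable x _)
        (hq.integrable_comp_mul ψ.integrable x _), (hp' x).2, (hq' x).2,
        deriv_fun_add (hp.differentiable x) (hq.differentiable x), add_div, Complex.ofReal_add]
  · rintro c p ⟨hp, hp'⟩
    refine ⟨hp.const_mul c, fun x => ⟨?_, ?_⟩⟩
    · simp only [Complex.ofReal_mul, mul_assoc]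
      rw [integral_const_mul, (hp' x).1]
    · rw [deriv_const_mul_field]
      simp only [Complex.ofReal_mul, mul_assoc]
      rw [integral_const_mul, (hp' x).2, mul_div_assoc, Complex.ofReal_mul]

theorem SchwartzMap.exists_norm_le_inv_one_add_pow (f : SchwartzMap ℝ ℂ) (m : ℕ) :
    ∃ C > 0, ∀ v, ‖f v‖ ≤ C * ((1 + |v|) ^ m)⁻¹ := by
  set C := 2 ^ m * ((Finset.Iic (m, 0)).sup fun m => SchwartzMap.seminorm ℂ m.1 m.2) f with hC
  have hC₀ : 0 ≤ C := mul_nonneg (by positivity) (apply_nonneg _ _)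
  refine ⟨C + 1, by positivity, fun v => ?_⟩
  have h := SchwartzMap.one_add_le_sup_seminorm_apply (𝕜 := ℂ) (m := (m, 0)) le_rfl le_rfl f v
  rw [norm_iteratedFDeriv_zero, Real.norm_eq_abs] at h
  rw [← div_eq_mul_inv, le_div_iff₀ (by positivity)]
  linarith

theorem integrable_inv_one_add_abs_pow {m : ℕ} (hm : 2 ≤ m) :
    Integrable fun v : ℝ => ((1 + |v|) ^ m)⁻¹ := by
  have h := integrable_one_add_norm (E := ℝ) (μ := volume) (r := m)
    (by rw [Module.finrank_self]; exact_mod_cast hm)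
  refine h.congr (Filter.Eventually.of_forall fun v => ?_)
  simp only
  rw [Real.rpow_neg (by positivity), Real.rpow_natCast, Real.norm_eq_abs]

/-- A trigonometric polynomial of degree `n` and its normalized derivative are dominated by an
average of its absolute value at scale `1 / n`. -/
theorem exists_abs_le_integral_translates {m : ℕ} (hm : 2 ≤ m) :
    ∃ C > 0, ∀ n : ℕ, 1 ≤ n → ∀ q : ℝ → ℝ, IsTrigPoly n q → ∀ x,
      |q x| ≤ C * ∫ v : ℝ, |q (x - v * (1 / n))| * ((1 + |v|) ^ m)⁻¹ ∧
      |deriv q x| ≤ n * (C * ∫ v : ℝ, |q (x - v * (1 / n))| * ((1 + |v|) ^ m)⁻¹) := by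
  obtain ⟨φ, hφ⟩ := exists_schwartzMap_fourier_eq_one
  obtain ⟨C₁, hC₁, h₁⟩ := φ.exists_norm_le_inv_one_add_pow m
  obtain ⟨C₂, hC₂, h₂⟩ := (SchwartzMap.derivCLM ℂ ℂ φ).exists_norm_le_inv_one_add_pow m
  refine ⟨max C₁ C₂, lt_max_of_lt_left hC₁, fun n hn q hq x => ?_⟩
  have hn₀ : (0 : ℝ) < n := by exact_mod_cast hn
  have key : ∀ f : ℝ → ℂ, (∀ v, ‖f v‖ ≤ max C₁ C₂ * ((1 + |v|) ^ m)⁻¹) →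
      ‖∫ v : ℝ, ((q (x - v * (1 / n)) : ℝ) : ℂ) * f v‖ ≤
        max C₁ C₂ * ∫ v : ℝ, |q (x - v * (1 / n))| * ((1 + |v|) ^ m)⁻¹ := fun f hf => by
    rw [← integral_const_mul]
    obtain ⟨B, hB⟩ := hq.exists_bound
    have hc := hq.continuous
    refine norm_integral_le_of_norm_le (((integrable_inv_one_add_abs_pow hm).bdd_mul (c := B)
      (f := fun v : ℝ => |q (x - v * (1 / n))|) (by fun_prop)
      (Filter.Eventually.of_forall fun v => ?_)).const_mul _)
      (Filter.Eventually.of_forall fun v => ?_)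
    · simpa using hB _
    · rw [norm_mul, Complex.norm_real, Real.norm_eq_abs, mul_left_comm]
      exact mul_le_mul_of_nonneg_left (hf v) (abs_nonneg _)
  obtain ⟨h₃, h₄⟩ := hq.reproducing hφ hn x
  constructor
  · have := key φ fun v => (h₁ v).trans (by gcongr; exact le_max_left _ _)
    rwa [h₃, Complex.norm_real, Real.norm_eq_abs] at this
  · have := key _ fun v => (h₂ v).trans (by gcongr; exact le_max_right _ _)
    rw [h₄, Complex.norm_real, Real.norm_eq_abs, abs_div, abs_of_pos hn₀, div_le_iff₀ hn₀] at this
    rwa [mul_comm]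

/-- The mean of `g` over translates at scale `h`, with polynomially decaying weight. -/
def translateMean (m : ℕ) (h : ℝ) (g : ℝ → ℝ) (x : ℝ) : ℝ :=
  ∫ v : ℝ, g (x - v * h) * ((1 + |v|) ^ m)⁻¹

section translateMean

variable {m : ℕ} {h B : ℝ} {g : ℝ → ℝ}

theorem integrable_translateMean (hm : 2 ≤ m) (hg : Continuous g) (hB : ∀ x, |g x| ≤ B) (x : ℝ) :
    Integrable fun v : ℝ => g (x - v * h) * ((1 + |v|) ^ m)⁻¹ :=
  (integrable_inv_one_add_abs_pow hm).bdd_mul (c := B) (by fun_prop)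
    (Filter.Eventually.of_forall fun _ => hB _)

theorem translateMean_nonneg (hg : ∀ x, 0 ≤ g x) (x : ℝ) : 0 ≤ translateMean m h g x :=
  integral_nonneg fun v => mul_nonneg (hg _) (by positivity)

theorem continuous_translateMean (hm : 2 ≤ m) (hg : Continuous g) (hB : ∀ x, |g x| ≤ B) :
    Continuous (translateMean m h g) := by
  refine continuous_of_dominated (bound := fun v => B * ((1 + |v|) ^ m)⁻¹)
    (fun x => (integrable_translateMean hm hg hB x).aestronglyMeasurable)
    (fun x => Filter.Eventually.of_forall fun v => ?_)
    ((integrable_inv_one_add_abs_pow hm).const_mul B)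
    (Filter.Eventually.of_forall fun v => by fun_prop)
  rw [Real.norm_eq_abs, abs_mul, abs_of_nonneg (a := ((1 + |v|) ^ m)⁻¹) (by positivity)]
  exact mul_le_mul_of_nonneg_right (hB _) (by positivity)

theorem periodic_translateMean {T : ℝ} (hg : Function.Periodic g T) :
    Function.Periodic (translateMean m h g) T := fun x => by
  simp only [translateMean, show ∀ v : ℝ, x + T - v * h = x - v * h + T from fun v => by ring,
    hg (x - _ * h)]

theorem translateMean_le_two_pow_mul (hm : 2 ≤ m) (hh : 0 < h) (hg : Continuous g)
    (hg₀ : ∀ x, 0 ≤ g x) (hB : ∀ x, |g x| ≤ B) {x y : ℝ} (hxy : |y - x| ≤ h) :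
    translateMean m h g y ≤ 2 ^ m * translateMean m h g x := by
  set t := (y - x) / h with ht
  have ht₁ : |t| ≤ 1 := by rwa [ht, abs_div, abs_of_pos hh, div_le_one hh]
  have hint := integrable_translateMean (h := h) hm hg hB
  rw [translateMean, translateMean, ← integral_const_mul,
    ← integral_add_right_eq_self (fun v : ℝ => g (y - v * h) * ((1 + |v|) ^ m)⁻¹) t]
  refine integral_mono ((hint y).comp_add_right t) ((hint x).const_mul _) fun v => ?_
  simp only
  rw [show y - (v + t) * h = x - v * h by rw [ht]; field_simp; ring, mul_left_comm]
  refine mul_le_mul_of_nonneg_left ?_ (hg₀ _)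
  rw [← div_eq_mul_inv, inv_eq_one_div, div_le_div_iff₀ (by positivity) (by positivity), one_mul,
    ← mul_pow]
  have : |v| ≤ |v + t| + |t| := by simpa using abs_sub (v + t) t
  exact pow_le_pow_left₀ (by positivity) (by linarith [abs_nonneg (v + t)]) m

/-- Averaging over translates is bounded on `L¹` for window masses of doubling weights. -/
theorem integral_translateMean_mul_windowMass_le {W : ℝ → ℝ} (hW : IsPeriodicWeight W) {L : ℝ}
    (hd : IsDoublingPeriodic W L) (hL : 0 ≤ L) {s : ℕ} (hs : L ≤ 2 ^ s) (hh : 0 < h)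
    (hg : Continuous g) (hg₀ : ∀ x, 0 ≤ g x) (hB : ∀ x, |g x| ≤ B)
    (hp : Function.Periodic g (2 * π)) :
    ∫ x in (-π)..π, translateMean (s + 2) h g x * windowMass W h x ≤
      (2 ^ s * ∫ v : ℝ, ((1 + |v|) ^ 2)⁻¹) * ∫ x in (-π)..π, g x * windowMass W h x := by
  have hM := hW.continuous_windowMass h
  have hππ : (-π : ℝ) ≤ π := by linarith [pi_pos]
  have hgM : Continuous fun x => g x * windowMass W h x := hg.mul hM
  set I := ∫ x in (-π)..π, g x * windowMass W h x with hI
  have hdom : Integrable (Function.uncurry fun x v : ℝ =>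
      (g (x - v * h) * ((1 + |v|) ^ (s + 2))⁻¹) * windowMass W h x)
      ((volume.restrict (uIoc (-π) π)).prod volume) := by
    have h₁ : Integrable (fun z : ℝ × ℝ => windowMass W h z.1 * ((1 + |z.2|) ^ (s + 2))⁻¹)
        ((volume.restrict (uIoc (-π) π)).prod volume) := by
      refine Integrable.mul_prod (f := windowMass W h) ?_
        (integrable_inv_one_add_abs_pow (by omega))
      exact (intervalIntegrable_iff.1 (hM.intervalIntegrable _ _))
    refine (h₁.bdd_mul (c := B) (f := fun z : ℝ × ℝ => g (z.1 - z.2 * h)) (by fun_prop)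
      (Filter.Eventually.of_forall fun z => hB _)).congr
      (Filter.Eventually.of_forall fun z => ?_)
    simp only [Function.uncurry]
    ring
  have hinner : ∀ v : ℝ, ∫ x in (-π)..π,
      (g (x - v * h) * ((1 + |v|) ^ (s + 2))⁻¹) * windowMass W h x ≤
      2 ^ s * ((1 + |v|) ^ 2)⁻¹ * I := fun v => by
    have h₁ : ∫ x in (-π)..π, g (x - v * h) * windowMass W h x =
        ∫ x in (-π)..π, g x * windowMass W h (x + v * h) := by
      have hper : Function.Periodic (fun x => g x * windowMass W h (x + v * h)) (2 * π) :=
        fun x => by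
          simp only
          rw [hp x, add_right_comm, hW.periodic_windowMass h]
      have h₂ := hper.intervalIntegral_add_eq (-π - v * h) (-π)
      have h₃ := intervalIntegral.integral_comp_sub_right (a := -π) (b := π)
        (fun x => g x * windowMass W h (x + v * h)) (v * h)
      simp only [sub_add_cancel] at h₃
      rw [show -π - v * h + 2 * π = π - v * h by ring, show -π + 2 * π = π by ring] at h₂
      rw [h₃, h₂]
    have h₂ : ∫ x in (-π)..π, g x * windowMass W h (x + v * h) ≤
        (2 * (1 + |v|)) ^ s * I := by
      rw [hI, ← intervalIntegral.integral_const_mul]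
      refine intervalIntegral.integral_mono_on hππ
        (Continuous.intervalIntegrable (hg.mul (hM.comp (by fun_prop))) _ _)
        (Continuous.intervalIntegrable (hgM.const_mul _) _ _) fun x _ => ?_
      rw [mul_left_comm]
      refine mul_le_mul_of_nonneg_left ?_ (hg₀ x)
      have h₃ := hW.windowMass_growth hd hL hs hh x (x + v * h)
      rwa [show |x - (x + v * h)| / h = |v| by
        rw [sub_add_cancel_left, abs_neg, abs_mul, abs_of_pos hh, mul_div_cancel_right₀ _ hh.ne']]
        at h₃
    calc _ = ((1 + |v|) ^ (s + 2))⁻¹ * ∫ x in (-π)..π, g (x - v * h) * windowMass W h x := by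
          rw [← intervalIntegral.integral_const_mul]
          congr 1
          ext x
          ring
      _ ≤ ((1 + |v|) ^ (s + 2))⁻¹ * ((2 * (1 + |v|)) ^ s * I) :=
          mul_le_mul_of_nonneg_left (h₁.trans_le h₂) (by positivity)
      _ = 2 ^ s * ((1 + |v|) ^ 2)⁻¹ * I := by
          have : 1 + |v| ≠ 0 := by positivity
          rw [mul_pow, pow_add]
          field_simp
  have hswap := intervalIntegral_integral_swap hdom
  have hintr := hdom.integral_prod_right
  calc ∫ x in (-π)..π, translateMean (s + 2) h g x * windowMass W h x
      = ∫ x in (-π)..π, ∫ v : ℝ,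
          (g (x - v * h) * ((1 + |v|) ^ (s + 2))⁻¹) * windowMass W h x := by
        simp only [translateMean, integral_mul_const]
    _ = ∫ v : ℝ, ∫ x in (-π)..π,
          (g (x - v * h) * ((1 + |v|) ^ (s + 2))⁻¹) * windowMass W h x := hswap
    _ ≤ ∫ v : ℝ, 2 ^ s * ((1 + |v|) ^ 2)⁻¹ * I := by
        refine integral_mono ?_ (((integrable_inv_one_add_abs_pow le_rfl).const_mul _).mul_const _)
          hinner
        simpa only [intervalIntegral.integral_of_le hππ, uIoc_of_le hππ, Function.uncurry]
          using hintr
    _ = (2 ^ s * ∫ v : ℝ, ((1 + |v|) ^ 2)⁻¹) * I := by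
        rw [integral_mul_const, integral_const_mul]

end translateMean

theorem abs_sub_le_mul_of_abs_deriv_le {f : ℝ → ℝ} (hf : Differentiable ℝ f) {x η c : ℝ}
    (h : ∀ z, |z - x| ≤ η → |deriv f z| ≤ c) {y : ℝ} (hy : |y - x| ≤ η) :
    |f y - f x| ≤ c * |y - x| :=
  Convex.norm_image_sub_le_of_norm_deriv_le (s := Metric.closedBall x η) (fun z _ => hf z)
    (fun z hz => h z hz) (convex_closedBall x η)
    (Metric.mem_closedBall_self ((abs_nonneg _).trans hy)) hy

/-- A trigonometric polynomial of degree `n` has a continuous majorant that controls it and its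
derivative locally at scale `1 / n` and has comparable weighted `L¹` norm. -/
theorem IsTrigPoly.exists_local_majorant {L : ℝ} (hL : 0 < L) :
    ∃ C > 0, ∀ W : ℝ → ℝ, IsPeriodicWeight W → IsDoublingPeriodic W L → ∀ n : ℕ, 1 ≤ n →
      ∀ q : ℝ → ℝ, IsTrigPoly n q → ∃ A : ℝ → ℝ, Continuous A ∧
        (∀ x θ, |θ - x| ≤ 1 / (n : ℝ) → |q θ| ≤ A x ∧ |_root_.deriv q θ| ≤ n * A x) ∧
        ∫ θ in (-π)..π, A θ * W θ ≤ C * ∫ θ in (-π)..π, |q θ| * W θ := by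
  obtain ⟨s, hs⟩ := pow_unbounded_of_one_lt L one_lt_two
  obtain ⟨K, hK, hmaj⟩ := exists_abs_le_integral_translates (m := s + 2) (by omega)
  set J := ∫ v : ℝ, ((1 + |v|) ^ 2)⁻¹ with hJ
  have hJ₀ : 0 ≤ J := integral_nonneg fun v => by positivity
  set C₂ := K * 2 ^ (s + 2) * (2 ^ s * J) with hC₂
  have hC₂₀ : 0 ≤ C₂ := by positivity
  obtain ⟨k, hk⟩ := pow_unbounded_of_one_lt (2 * C₂ + 1) one_lt_two
  refine ⟨2 ^ (s + 2) * (C₂ + 1) * (2 * L ^ k), by positivity, fun W hW hd n hn q hq => ?_⟩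
  have hn₀ : (0 : ℝ) < n := by exact_mod_cast hn
  have hππ : (-π : ℝ) ≤ π := by linarith [pi_pos]
  set h : ℝ := 1 / n with hh
  have hh₀ : 0 < h := by positivity
  have hm : 2 ≤ s + 2 := by omega
  obtain ⟨B, hB⟩ := hq.exists_bound
  have hB' : ∀ x, |(fun x => |q x|) x| ≤ B := fun x => by simpa using hB x
  have hqc : Continuous fun x => |q x| := hq.continuous.abs
  have hqp : Function.Periodic (fun x => |q x|) (2 * π) := fun x => by
    simp only [hq.periodic x]
  have hq₀ : ∀ x, 0 ≤ (fun x => |q x|) x := fun x => abs_nonneg _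
  set A₀ := translateMean (s + 2) h fun x => |q x| with hA₀
  set A : ℝ → ℝ := fun x => K * 2 ^ (s + 2) * A₀ x with hA
  have hA₀c : Continuous A₀ := continuous_translateMean hm hqc hB'
  have hA₀p : Function.Periodic A₀ (2 * π) := periodic_translateMean hqp
  have hA₀n : ∀ x, 0 ≤ A₀ x := translateMean_nonneg hq₀
  have hAc : Continuous A := hA₀c.const_mul _
  have hAp : Function.Periodic A (2 * π) := fun x => by simp only [hA, hA₀p x]
  have hAn : ∀ x, 0 ≤ A x := fun x => mul_nonneg (by positivity) (hA₀n x)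
  have hslow : ∀ x θ, |θ - x| ≤ h → A₀ θ ≤ 2 ^ (s + 2) * A₀ x := fun x θ hx =>
    translateMean_le_two_pow_mul hm hh₀ hqc hq₀ hB' hx
  have hbd : ∀ x θ, |θ - x| ≤ h → |q θ| ≤ A x ∧ |_root_.deriv q θ| ≤ n * A x := fun x θ hx => by
    have h₁ : K * A₀ θ ≤ A x := by
      simp only [hA, mul_assoc]
      exact mul_le_mul_of_nonneg_left (hslow x θ hx) hK.le
    have h₂ := hmaj n hn q hq θ
    exact ⟨h₂.1.trans h₁, h₂.2.trans (mul_le_mul_of_nonneg_left h₁ hn₀.le)⟩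
  refine ⟨A, hAc, hbd, ?_⟩
  set M := windowMass W h with hM
  have hMc : Continuous M := hW.continuous_windowMass h
  set I := ∫ x in (-π)..π, |q x| * M x with hI
  have hAM : ∫ x in (-π)..π, A x * M x ≤ C₂ * I := by
    have := integral_translateMean_mul_windowMass_le hW hd hL.le hs.le hh₀ hqc hq₀ hB' hqp
    simp only [hA, mul_assoc, intervalIntegral.integral_const_mul]
    rw [hC₂, mul_assoc, mul_assoc, mul_assoc]
    refine mul_le_mul_of_nonneg_left (mul_le_mul_of_nonneg_left ?_ (by positivity)) hK.le
    rwa [← mul_assoc]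
  have hAW : 2 * h * ∫ x in (-π)..π, A x * W x ≤ 2 ^ (s + 2) * (C₂ * I) := by
    rw [← hW.integral_windowMass_mul hAc hAp h]
    refine le_trans ?_ (mul_le_mul_of_nonneg_left hAM (by positivity))
    rw [← intervalIntegral.integral_const_mul]
    refine intervalIntegral.integral_mono_on hππ
      ((hW.continuous_windowMass_mul hAc h).intervalIntegrable _ _)
      (((hAc.mul hMc).const_mul _).intervalIntegrable _ _) fun x _ => ?_
    rw [← mul_assoc]
    refine hW.windowMass_mul_le hAc hh₀.le fun θ hθ => ?_
    simp only [hA]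
    rw [mul_left_comm]
    exact mul_le_mul_of_nonneg_left (hslow x θ hθ) (by positivity)
  set η := h / 2 ^ k with hη
  have hη₀ : 0 < η := by positivity
  have hηh : η ≤ h := div_le_self hh₀.le (one_le_pow₀ one_le_two)
  have hqW : (∫ x in (-π)..π, (|q x| - η * n * A x) * M x) ≤
      L ^ k * (2 * η * ∫ x in (-π)..π, |q x| * W x) := by
    rw [← hW.integral_windowMass_mul hqc hqp η, ← intervalIntegral.integral_const_mul]
    refine intervalIntegral.integral_mono_on hππ
      (((hqc.sub (hAc.const_mul _)).mul hMc).intervalIntegrable _ _)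
      (((hW.continuous_windowMass_mul hqc η).const_mul _).intervalIntegrable _ _) fun x _ => ?_
    have hWη := hW.windowMass_nonneg hη₀.le x
    rcases le_total (|q x| - η * n * A x) 0 with hneg | hpos
    · refine (mul_nonpos_of_nonpos_of_nonneg hneg (hW.windowMass_nonneg hh₀.le x)).trans ?_
      refine mul_nonneg (by positivity) (le_trans ?_ (hW.le_windowMass_mul hqc hη₀.le
        (c := 0) fun θ _ => hq₀ θ))
      rw [zero_mul]
    · have h₁ : (|q x| - η * n * A x) * windowMass W η x ≤
          windowMass (fun θ => |q θ| * W θ) η x := by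
        refine hW.le_windowMass_mul hqc hη₀.le fun θ hθ => ?_
        have h₂ := abs_sub_le_mul_of_abs_deriv_le hq.differentiable
          (fun z hz => (hbd x z (hz.trans hηh)).2) hθ
        rw [abs_sub_comm (q θ)] at h₂
        have h₃ : n * A x * |θ - x| ≤ n * A x * η :=
          mul_le_mul_of_nonneg_left hθ (mul_nonneg hn₀.le (hAn x))
        have h₄ := abs_sub_abs_le_abs_sub (q x) (q θ)
        linarith
      calc (|q x| - η * n * A x) * M x
          ≤ (|q x| - η * n * A x) * (L ^ k * windowMass W η x) :=
            mul_le_mul_of_nonneg_left (hW.windowMass_le_of_two_pow hd hL.le hη₀ hh₀.le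
              (by rw [hη]; field_simp; rfl) x) hpos
        _ = L ^ k * ((|q x| - η * n * A x) * windowMass W η x) := by ring
        _ ≤ _ := mul_le_mul_of_nonneg_left h₁ (by positivity)
  have hsplit : ∫ x in (-π)..π, (|q x| - η * n * A x) * M x =
      I - η * n * ∫ x in (-π)..π, A x * M x := by
    have h₁ : IntervalIntegrable (fun x => |q x| * M x) volume (-π) π :=
      (hqc.mul hMc).intervalIntegrable _ _
    have h₂ : IntervalIntegrable (fun x => η * n * (A x * M x)) volume (-π) π :=
      ((hAc.mul hMc).const_mul _).intervalIntegrable _ _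
    rw [hI, ← intervalIntegral.integral_const_mul, ← intervalIntegral.integral_sub h₁ h₂]
    congr 1
    ext x
    ring
  have hηn : η * n = 1 / 2 ^ k := by rw [hη, hh]; field_simp
  have hI₀ : 0 ≤ I := intervalIntegral.integral_nonneg hππ fun x _ =>
    mul_nonneg (abs_nonneg _) (hW.windowMass_nonneg hh₀.le x)
  have hhalf : η * n * ∫ x in (-π)..π, A x * M x ≤ I / 2 := by
    refine (mul_le_mul_of_nonneg_left hAM (by positivity)).trans ?_
    rw [hηn, one_div_mul_eq_div, div_le_div_iff₀ (by positivity) two_pos]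
    nlinarith
  set X := ∫ x in (-π)..π, |q x| * W x with hX
  have hX₀ : 0 ≤ X := hW.integral_mul_nonneg hq₀ hππ
  have hI' : I ≤ 2 * L ^ k * (2 * h * X) := by
    have h₁ : L ^ k * (2 * η * X) ≤ L ^ k * (2 * h * X) := by gcongr
    linarith [hsplit ▸ hqW]
  have h₁ : 2 * h * ∫ x in (-π)..π, A x * W x ≤
      2 * h * (2 ^ (s + 2) * (C₂ + 1) * (2 * L ^ k) * X) := by
    calc _ ≤ 2 ^ (s + 2) * (C₂ * I) := hAW
      _ ≤ 2 ^ (s + 2) * ((C₂ + 1) * (2 * L ^ k * (2 * h * X))) := by gcongr; linarith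
      _ = _ := by ring
  exact le_of_mul_le_mul_left h₁ (by positivity)

open Filter Topology in
/-- If the linearized equation `f' x v = -f x₀` has solutions of norm at most `κ` at all points of
the ball of radius `κ` about `x₀`, then `f` vanishes somewhere in that ball. -/
theorem exists_eq_zero_of_forall_exists_fderiv_eq {E F : Type*} [NormedAddCommGroup E]
    [NormedSpace ℝ E] [ProperSpace E] [NormedAddCommGroup F] [NormedSpace ℝ F] {f : E → F}
    {f' : E → E →L[ℝ] F} (hf : ∀ x, HasFDerivAt f (f' x) x) {x₀ : E} {κ : ℝ} (hκ : 0 ≤ κ)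
    (hv : ∀ x, ‖x - x₀‖ ≤ κ → ∃ v, ‖v‖ ≤ κ ∧ f' x v = -f x₀) :
    ∃ x, ‖x - x₀‖ ≤ κ ∧ f x = 0 := by
  have hfc : Continuous f := continuous_iff_continuousAt.2 fun x => (hf x).continuousAt
  have approx : ∀ K : ℝ, 0 < K → ∃ x, ‖x - x₀‖ ≤ κ ∧ K * ‖f x‖ ≤ 1 := by
    intro K hK
    let S : Set (E × ℝ) := {z | z.2 ∈ Icc (0 : ℝ) 1 ∧ ‖z.1 - x₀‖ ≤ κ * z.2}
    let G : E × ℝ → ℝ := fun z => K * ‖f z.1 - (1 - z.2) • f x₀‖ - z.2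
    have hS : IsCompact S := by
      refine ((isCompact_closedBall x₀ κ).prod
        (isCompact_Icc (a := (0 : ℝ)) (b := 1))).of_isClosed_subset ?_ ?_
      · exact (isClosed_Icc.preimage continuous_snd).inter
          (isClosed_le (f := fun z : E × ℝ => ‖z.1 - x₀‖) (g := fun z => κ * z.2)
            (by fun_prop) (by fun_prop))
      · rintro ⟨x, s⟩ ⟨hs, hx⟩
        refine ⟨?_, hs⟩
        rw [mem_closedBall_iff_norm]
        exact hx.trans (mul_le_of_le_one_right hκ hs.2)
    have h₀ : (x₀, (0 : ℝ)) ∈ S := ⟨by simp, by simp⟩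
    obtain ⟨⟨x, s⟩, ⟨hs, hx⟩, hmin⟩ := hS.exists_isMinOn (f := G) ⟨_, h₀⟩ (by fun_prop)
    simp only at hs hx
    have hxκ : ‖x - x₀‖ ≤ κ := hx.trans (mul_le_of_le_one_right hκ hs.2)
    have hs₁ : s = 1 := by
      by_contra hne
      have hlt : s < 1 := lt_of_le_of_ne hs.2 hne
      obtain ⟨v, hvκ, hfv⟩ := hv x hxκ
      have hline : HasDerivAt (fun t : ℝ => f (x + t • v)) (-f x₀) 0 := by
        rw [← hfv]
        exact (hf x).hasLineDerivAt v
      have hlo := hline.isLittleO.def (c := 1 / (2 * K)) (by positivity)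
      have hev : ∀ᶠ t in 𝓝[>] (0 : ℝ), t < 1 - s := by
        filter_upwards [Ioo_mem_nhdsGT (show (0 : ℝ) < 1 - s by linarith)] with t ht using ht.2
      obtain ⟨t, ⟨ht, hts⟩, ht₀⟩ :=
        (((hlo.filter_mono nhdsWithin_le_nhds).and hev).and self_mem_nhdsWithin).exists
      replace ht₀ : 0 < t := ht₀
      simp only [zero_smul, add_zero, sub_zero, smul_neg, sub_neg_eq_add, Real.norm_eq_abs,
        abs_of_pos ht₀] at ht
      have hmem : (x + t • v, s + t) ∈ S := by
        refine ⟨⟨by linarith [hs.1], by linarith⟩, ?_⟩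
        calc ‖x + t • v - x₀‖ = ‖(x - x₀) + t • v‖ := by congr 1; abel
          _ ≤ κ * s + t * κ := (norm_add_le _ _).trans (add_le_add hx (by
              rw [norm_smul, Real.norm_eq_abs, abs_of_pos ht₀]
              exact mul_le_mul_of_nonneg_left hvκ ht₀.le))
          _ = κ * (s + t) := by ring
      have h₁ : G (x, s) ≤ G (x + t • v, s + t) := hmin hmem
      have h₂ : ‖f (x + t • v) - (1 - (s + t)) • f x₀‖ ≤
          ‖f x - (1 - s) • f x₀‖ + 1 / (2 * K) * t := by
        refine le_trans (le_of_eq_of_le ?_ (norm_add_le _ _)) (add_le_add_right ht _)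
        congr 1
        module
      have h₃ := mul_le_mul_of_nonneg_left h₂ hK.le
      have h₄ : K * (1 / (2 * K) * t) = t / 2 := by field_simp
      simp only [G] at h₁
      rw [mul_add, h₄] at h₃
      linarith
    subst hs₁
    refine ⟨x, hxκ, ?_⟩
    have := hmin h₀
    simp only [G, mem_ofPred_eq, sub_self, zero_smul, sub_zero, one_smul, norm_zero, mul_zero]
      at this
    linarith
  obtain ⟨x, hx, hmin⟩ := (isCompact_closedBall x₀ κ).exists_isMinOn
    (Metric.nonempty_closedBall.2 hκ) hfc.norm.continuousOn
  refine ⟨x, mem_closedBall_iff_norm.1 hx, norm_le_zero_iff.1 (le_of_forall_pos_le_add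
    fun ε hε => ?_)⟩
  obtain ⟨y, hy, hfy⟩ := approx (1 / ε) (by positivity)
  have h₁ : ‖f x‖ ≤ ‖f y‖ := hmin (mem_closedBall_iff_norm.2 hy)
  rw [one_div_mul_eq_div, div_le_one hε] at hfy
  linarith

/-- Duality criterion for solving a linear equation in a sup-norm ball. -/
theorem exists_norm_le_apply_eq {ι F : Type*} [Fintype ι] [DecidableEq ι] [NormedAddCommGroup F]
    [NormedSpace ℝ F] (D : (ι → ℝ) →L[ℝ] F) {y : F} {κ : ℝ} (hκ : 0 ≤ κ)
    (h : ∀ g : F →L[ℝ] ℝ, |g y| ≤ κ * ∑ i, |g (D (Pi.single i 1))|) :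
    ∃ v, ‖v‖ ≤ κ ∧ D v = y := by
  by_contra! hne
  have hy : y ∉ D '' Metric.closedBall 0 κ := by
    rintro ⟨v, hv, rfl⟩
    exact hne v (mem_closedBall_zero_iff.1 hv) rfl
  obtain ⟨g, u, h₁, h₂⟩ := geometric_hahn_banach_closed_point
    ((convex_closedBall (0 : ι → ℝ) κ).is_linear_image D.isBoundedLinearMap.toIsLinearMap)
    ((isCompact_closedBall (0 : ι → ℝ) κ).image D.continuous).isClosed hy
  set a : ι → ℝ := fun i => g (D (Pi.single i 1)) with ha
  have hv : (fun i => κ * SignType.sign (a i)) ∈ Metric.closedBall (0 : ι → ℝ) κ := by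
    rw [mem_closedBall_zero_iff, pi_norm_le_iff_of_nonneg hκ]
    intro i
    rcases lt_trichotomy (a i) 0 with h | h | h <;> simp [h, abs_of_nonneg hκ, hκ]
  have h₃ := h₁ _ ⟨_, hv, rfl⟩
  have h₄ : g (D fun i => κ * SignType.sign (a i)) = κ * ∑ i, |a i| := by
    have := LinearMap.pi_apply_eq_sum_univ ((g.comp D : (ι → ℝ) →L[ℝ] ℝ) : (ι → ℝ) →ₗ[ℝ] ℝ)
      fun i => κ * SignType.sign (a i)
    simp only [ContinuousLinearMap.coe_coe, ContinuousLinearMap.comp_apply, smul_eq_mul] at this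
    rw [this, Finset.mul_sum]
    refine Finset.sum_congr rfl fun i _ => ?_
    rw [mul_assoc]
    congr 1
    rw [← sign_mul_self (a i)]
    congr 3
    ext j
    simp [Pi.single_apply, eq_comm]
  rw [h₄] at h₃
  linarith [h g, le_abs_self (g y)]

namespace IsPeriodicWeight

variable {W : ℝ → ℝ}

/-- A partition of a period into `N` intervals of equal weight. -/
theorem exists_equal_weight_partition (hW : IsPeriodicWeight W) {N : ℕ} (hN : 0 < N) :
    ∃ t : ℕ → ℝ, t 0 = -π ∧ t N = π ∧ ∀ i < N, t i ≤ t (i + 1) ∧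
      ∫ θ in (t i)..(t (i + 1)), W θ = (∫ θ in (-π)..π, W θ) / N := by
  set T := ∫ θ in (-π)..π, W θ with hT
  set Φ : ℝ → ℝ := fun x => ∫ θ in (-π)..x, W θ with hΦ
  have hT₀ : 0 < T := hW.integral_pos
  have hN₀ : (0 : ℝ) < N := by exact_mod_cast hN
  have hππ : (-π : ℝ) ≤ π := by linarith [pi_pos]
  have hΦc : Continuous Φ := intervalIntegral.continuous_primitive hW.intervalIntegrable _
  have hΦs : ∀ x y, Φ y - Φ x = ∫ θ in x..y, W θ := fun x y =>
    intervalIntegral.integral_interval_sub_left (hW.intervalIntegrable _ _)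
      (hW.intervalIntegrable _ _)
  have hΦm : Monotone Φ := fun x y hxy => by
    have := intervalIntegral.integral_nonneg (μ := volume) hxy fun θ _ => hW.nonneg θ
    linarith [hΦs x y]
  have hex : ∀ i : ℕ, ∃ x, (i ≤ N → Φ x = i * (T / N)) ∧ (i = 0 → x = -π) ∧ (i = N → x = π) := by
    intro i
    rcases Nat.eq_zero_or_pos i with rfl | hi
    · exact ⟨-π, fun _ => by simp [hΦ], fun _ => rfl, fun h => absurd h hN.ne⟩
    rcases lt_trichotomy i N with hiN | rfl | hiN
    · have hmem : i * (T / N) ∈ Icc (Φ (-π)) (Φ π) := by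
        have h₁ : (i : ℝ) ≤ N := by exact_mod_cast hiN.le
        constructor
        · simp only [hΦ, intervalIntegral.integral_same]
          positivity
        · calc i * (T / N) ≤ N * (T / N) := by gcongr
            _ = T := by field_simp
      obtain ⟨x, -, hx⟩ := intermediate_value_Icc hππ hΦc.continuousOn hmem
      exact ⟨x, fun _ => hx, fun h => absurd h hi.ne', fun h => absurd h hiN.ne⟩
    · exact ⟨π, fun _ => by field_simp; rfl, fun h => absurd h hi.ne', fun _ => rfl⟩
    · exact ⟨0, fun h => absurd h (not_le.2 hiN), fun h => absurd h hi.ne',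
        fun h => absurd h hiN.ne'⟩
  choose t ht h0 h1 using hex
  refine ⟨t, h0 0 rfl, h1 N rfl, fun i hi => ?_⟩
  have h₁ : Φ (t (i + 1)) - Φ (t i) = T / N := by
    rw [ht i hi.le, ht (i + 1) hi]
    push_cast
    ring
  refine ⟨?_, by rw [← hΦs, h₁]⟩
  by_contra! hlt
  have h₂ := hΦm hlt.le
  have h₃ : 0 < T / N := by positivity
  linarith

/-- Error bound for a Riemann sum over an equal weight partition. -/
theorem abs_sum_sub_integral_le (hW : IsPeriodicWeight W) {N : ℕ} {t : ℕ → ℝ} {w : ℝ}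
    (ht₀ : t 0 = -π) (htN : t N = π)
    (ht : ∀ i < N, t i ≤ t (i + 1) ∧ ∫ θ in (t i)..(t (i + 1)), W θ = w)
    {g A : ℝ → ℝ} (hg : Continuous g) (hA : Continuous A) {y : Fin N → ℝ}
    (h : ∀ i : Fin N, ∀ θ ∈ Icc (t i) (t (i + 1)), |y i - g θ| ≤ A θ) :
    |w * ∑ i, y i - ∫ θ in (-π)..π, g θ * W θ| ≤ ∫ θ in (-π)..π, A θ * W θ := by
  have hsum : ∀ {u : ℝ → ℝ}, Continuous u → ∫ θ in (-π)..π, u θ * W θ =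
      ∑ i : Fin N, ∫ θ in (t i)..(t (i + 1)), u θ * W θ := fun {u} hu => by
    have h₁ := intervalIntegral.sum_integral_adjacent_intervals (a := t) (n := N)
      (f := fun θ => u θ * W θ) (μ := volume) fun k _ => hW.intervalIntegrable_mul hu _ _
    rw [ht₀, htN] at h₁
    rw [← h₁, Finset.sum_range]
  have hint := fun {u : ℝ → ℝ} (hu : Continuous u) (a b : ℝ) => hW.intervalIntegrable_mul hu a b
  rw [hsum hg, hsum hA, Finset.mul_sum, ← Finset.sum_sub_distrib]
  refine (Finset.abs_sum_le_sum_abs _ _).trans (Finset.sum_le_sum fun i _ => ?_)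
  obtain ⟨hle, hmass⟩ := ht i i.2
  have hconst : w * y i = ∫ θ in (t i)..(t (i + 1)), y i * W θ := by
    rw [intervalIntegral.integral_const_mul, hmass, mul_comm]
  rw [hconst]
  have h₁ := hW.integral_mul_mono (g' := fun θ => y i + A θ) hg (by fun_prop) hle fun θ hθ => by
    linarith [(abs_le.1 (h i θ hθ)).1]
  have h₂ := hW.integral_mul_mono (g := fun _ => y i) (g' := fun θ => g θ + A θ)
    continuous_const (by fun_prop) hle fun θ hθ => by linarith [(abs_le.1 (h i θ hθ)).2]
  simp only [add_mul] at h₁ h₂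
  rw [intervalIntegral.integral_add (hint continuous_const _ _) (hint hA _ _)] at h₁
  rw [intervalIntegral.integral_add (hint hg _ _) (hint hA _ _)] at h₂
  exact abs_le.2 ⟨by linarith, by linarith⟩

/-- Intervals of small weight are short. -/
theorem sub_le_of_integral_lt (hW : IsPeriodicWeight W) {L : ℝ} (hd : IsDoublingPeriodic W L)
    (hL : 0 < L) {n : ℕ} (hn : 1 ≤ n) {k : ℕ} {a b : ℝ}
    (h : L ^ k * ∫ θ in a..b, W θ < (∫ θ in (-π)..π, W θ) / Rtrig W n) :
    b - a ≤ 2 / (2 ^ k * n) := by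
  have hn₀ : (0 : ℝ) < n := by exact_mod_cast hn
  by_contra! hlt
  set η : ℝ := 1 / (2 ^ k * n) with hη
  have hη₀ : 0 < η := by positivity
  have hη₂ : 2 / (2 ^ k * n) = 2 * η := by rw [hη]; ring
  rw [hη₂] at hlt
  have h₁ : windowMass W η ((a + b) / 2) ≤ ∫ θ in a..b, W θ :=
    intervalIntegral.integral_mono_interval (by linarith) (by linarith) (by linarith)
      (Filter.Eventually.of_forall hW.nonneg) (hW.intervalIntegrable _ _)
  have h₂ := hW.windowMass_le_of_two_pow (δ := 1 / n) (k := k) hd hL.le hη₀ (by positivity)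
    (by rw [hη]; field_simp; rfl) ((a + b) / 2)
  have h₃ := (hW.integral_div_le_windowMass hd hL hn).2 ((a + b) / 2)
  have h₄ := mul_le_mul_of_nonneg_left h₁ (pow_pos hL k).le
  linarith

end IsPeriodicWeight

/-- For finitely many trigonometric polynomials of degree at most `n` there are exact equal-weight
quadrature nodes as soon as the number of nodes is large compared with `Rtrig W n`. -/
theorem exists_nodes_of_mul_Rtrig_le {L : ℝ} (hL : 0 < L) :
    ∃ C > 0, ∀ W : ℝ → ℝ, IsPeriodicWeight W → IsDoublingPeriodic W L → ∀ n : ℕ, 1 ≤ n →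
      ∀ N : ℕ, C * Rtrig W n ≤ N → ∀ {J : Type} [Fintype J] (e : J → ℝ → ℝ),
        (∀ j, IsTrigPoly n (e j)) → ∃ x : Fin N → ℝ, ∀ j,
          ∫ θ in (-π)..π, e j θ * W θ = ((∫ θ in (-π)..π, W θ) / N) * ∑ i, e j (x i) := by
  obtain ⟨C, hC, hmaj⟩ := IsTrigPoly.exists_local_majorant hL
  obtain ⟨k, hk⟩ := pow_unbounded_of_one_lt (4 * (1 + 2 * C) * (1 + C)) one_lt_two
  refine ⟨2 * L ^ k, by positivity, fun W hW hd n hn N hN J _ e he => ?_⟩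
  classical
  have hn₀ : (0 : ℝ) < n := by exact_mod_cast hn
  obtain ⟨hR, -⟩ := hW.integral_div_le_windowMass hd hL hn
  have hT := hW.integral_pos
  have hππ : (-π : ℝ) ≤ π := by linarith [pi_pos]
  have hN₀ : (0 : ℝ) < N := lt_of_lt_of_le (by positivity) hN
  obtain ⟨t, ht₀, htN, ht⟩ := hW.exists_equal_weight_partition (by exact_mod_cast hN₀)
  set T := ∫ θ in (-π)..π, W θ with hTdef
  set w := T / N with hw
  have hw₀ : 0 < w := by positivity
  set δ : ℝ := 2 / (2 ^ k * n) with hδ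
  have hδ₀ : 0 < δ := by positivity
  have hδn : δ * n = 2 / 2 ^ k := by rw [hδ]; field_simp
  set κ : ℝ := 2 * δ * C with hκ
  have hκ₀ : 0 < κ := by positivity
  have hsmall : (δ + κ) * n * (1 + C) ≤ 1 / 2 := by
    have h₁ : (δ + κ) * n * (1 + C) = 2 * ((1 + 2 * C) * (1 + C)) / 2 ^ k := by
      rw [hκ, show (δ + 2 * δ * C) * n = δ * n * (1 + 2 * C) by ring, hδn]
      ring
    rw [h₁, div_le_div_iff₀ (by positivity) two_pos]
    linarith
  have hscale : δ + κ ≤ 1 / n := by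
    rw [le_div_iff₀ hn₀]
    nlinarith [mul_pos (mul_pos (add_pos hδ₀ hκ₀) hn₀) hC]
  have hlen : ∀ i < N, t (i + 1) - t i ≤ δ := fun i hi => by
    refine hW.sub_le_of_integral_lt hd hL hn ?_
    rw [(ht i hi).2, ← hTdef, hw, ← mul_div_assoc, div_lt_div_iff₀ hN₀ hR]
    have : L ^ k * T * Rtrig W n > 0 := by positivity
    nlinarith
  let f : (Fin N → ℝ) → J → ℝ := fun x j => w * ∑ i, e j (x i) - ∫ θ in (-π)..π, e j θ * W θ
  let f' : (Fin N → ℝ) → (Fin N → ℝ) →L[ℝ] J → ℝ := fun x => ContinuousLinearMap.pi fun j =>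
    w • ∑ i, deriv (e j) (x i) • ContinuousLinearMap.proj i
  have hf : ∀ x, HasFDerivAt f (f' x) x := fun x => by
    refine hasFDerivAt_pi.2 fun j => ((HasFDerivAt.fun_sum fun i _ => ?_).const_mul w).sub_const _
    exact ((he j).differentiable (x i)).hasDerivAt.comp_hasFDerivAt x (hasFDerivAt_apply i x)
  obtain ⟨x, -, hx⟩ := exists_eq_zero_of_forall_exists_fderiv_eq hf (x₀ := fun i => t i) hκ₀.le
    fun x hx => exists_norm_le_apply_eq (f' x) hκ₀.le fun g => by
      set c : J → ℝ := fun j => g (Pi.single j 1) with hc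
      have hg : ∀ y : J → ℝ, g y = ∑ j, c j * y j := fun y => by
        have := LinearMap.pi_apply_eq_sum_univ (g : (J → ℝ) →ₗ[ℝ] ℝ) y
        simp only [ContinuousLinearMap.coe_coe, smul_eq_mul] at this
        rw [this]
        refine Finset.sum_congr rfl fun j _ => ?_
        rw [mul_comm, hc]
        congr 2
        ext l
        simp [Pi.single_apply, eq_comm]
      set P : ℝ → ℝ := fun θ => ∑ j, c j * e j θ with hP
      have hPt : IsTrigPoly n P := IsTrigPoly.sum _ fun j _ => (he j).const_mul (c j)
      have hPd : ∀ θ, deriv P θ = ∑ j, c j * deriv (e j) θ := fun θ =>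
        (HasDerivAt.fun_sum fun j _ =>
          ((he j).differentiable θ).hasDerivAt.const_mul (c j)).deriv
      have hgf : g (-f fun i => t i) =
          -(w * ∑ i : Fin N, P (t i) - ∫ θ in (-π)..π, P θ * W θ) := by
        have h₁ : ∫ θ in (-π)..π, P θ * W θ = ∑ j, c j * ∫ θ in (-π)..π, e j θ * W θ := by
          simp only [hP, Finset.sum_mul, mul_assoc]
          rw [intervalIntegral.integral_finsetSum fun j _ =>
            (hW.intervalIntegrable_mul (he j).continuous _ _).const_mul (c j)]
          simp only [intervalIntegral.integral_const_mul]
        rw [map_neg, hg, h₁]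
        simp only [f, mul_sub, Finset.sum_sub_distrib, hP]
        rw [Finset.sum_comm, Finset.mul_sum]
        simp only [Finset.mul_sum, mul_left_comm w]
      have hgD : ∀ i, g (f' x (Pi.single i 1)) = w * deriv P (x i) := fun i => by
        rw [hg, hPd, Finset.mul_sum]
        refine Finset.sum_congr rfl fun j _ => ?_
        simp [f', Pi.single_apply, mul_left_comm]
      obtain ⟨A, hAc, hAq, hAW⟩ := hmaj W hW hd n hn _ hPt.deriv
      set X := ∫ θ in (-π)..π, |deriv P θ| * W θ with hX
      have hX₀ : 0 ≤ X := hW.integral_mul_nonneg (fun _ => abs_nonneg _) hππ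
      have hAn : ∀ θ, 0 ≤ A θ := fun θ => (abs_nonneg _).trans
        (hAq θ θ (by rw [sub_self, abs_zero]; positivity)).1
      have hnode : ∀ i : Fin N, ∀ θ ∈ Icc (t i) (t (i + 1)), |t i - θ| ≤ δ := fun i θ hθ =>
        abs_le.2 ⟨by linarith [hlen i i.2, hθ.2], by linarith [hθ.1]⟩
      have h₁ : |w * ∑ i : Fin N, P (t i) - ∫ θ in (-π)..π, P θ * W θ| ≤ δ * (C * X) := by
        refine (hW.abs_sum_sub_integral_le ht₀ htN ht hPt.continuous (hAc.const_mul δ)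
          fun i θ hθ => ?_).trans ?_
        · have h₂ := abs_sub_le_mul_of_abs_deriv_le hPt.differentiable (c := A θ)
            (fun z hz => (hAq θ z (hz.trans (by linarith))).1) (hnode i θ hθ)
          refine h₂.trans ?_
          rw [mul_comm]
          exact mul_le_mul_of_nonneg_right (hnode i θ hθ) (hAn θ)
        · simp only [mul_assoc, intervalIntegral.integral_const_mul]
          exact mul_le_mul_of_nonneg_left hAW hδ₀.le
      have h₂ : |w * ∑ i, |deriv P (x i)| - X| ≤ (δ + κ) * n * (C * X) := by
        refine (hW.abs_sum_sub_integral_le ht₀ htN ht hPt.deriv.continuous.abs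
          (hAc.const_mul ((δ + κ) * n)) fun i θ hθ => ?_).trans ?_
        · have hxθ : |x i - θ| ≤ δ + κ := by
            have h₃ : |x i - t i| ≤ κ := (norm_le_pi_norm (x - fun i : Fin N => t i) i).trans hx
            linarith [abs_sub_le (x i) (t i) θ, hnode i θ hθ]
          have h₃ := abs_sub_le_mul_of_abs_deriv_le hPt.deriv.differentiable (c := n * A θ)
            (fun z hz => (hAq θ z (hz.trans hscale)).2) hxθ
          refine (abs_abs_sub_abs_le _ _).trans (h₃.trans ?_)
          calc n * A θ * |x i - θ| ≤ n * A θ * (δ + κ) :=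
                mul_le_mul_of_nonneg_left hxθ (mul_nonneg hn₀.le (hAn θ))
            _ = (δ + κ) * n * A θ := by ring
        · simp only [mul_assoc _ (A _), intervalIntegral.integral_const_mul]
          exact mul_le_mul_of_nonneg_left hAW (by positivity)
      have h₃ : (δ + κ) * n * (C * X) ≤ X / 2 := by
        have h₄ : (δ + κ) * n * C ≤ 1 / 2 := by
          have : 0 ≤ (δ + κ) * n := by positivity
          linarith
        nlinarith
      have h₄ : X ≤ 2 * (w * ∑ i, |deriv P (x i)|) := by linarith [(abs_le.1 h₂).1]
      rw [hgf, abs_neg]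
      simp only [hgD, abs_mul, abs_of_pos hw₀, ← Finset.mul_sum]
      calc _ ≤ δ * (C * X) := h₁
        _ ≤ δ * (C * (2 * (w * ∑ i, |deriv P (x i)|))) := by gcongr
        _ = _ := by rw [hκ]; ring
  exact ⟨x, fun j => (sub_eq_zero.1 (congrFun hx j)).symm⟩

theorem IsTrigChebQuad.exists_of_mul_Rtrig_le {L : ℝ} (hL : 0 < L) :
    ∃ C > 0, ∀ W : ℝ → ℝ, IsPeriodicWeight W → IsDoublingPeriodic W L → ∀ n : ℕ, 1 ≤ n →
      ∀ N : ℕ, C * Rtrig W n ≤ N → ∃ θs : Fin N → ℝ, IsTrigChebQuad W n N θs := by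
  obtain ⟨C, hC, hnodes⟩ := exists_nodes_of_mul_Rtrig_le hL
  refine ⟨C, hC, fun W hW hd n hn N hN => ?_⟩
  have hN₀ : (0 : ℝ) < N :=
    (mul_pos hC (hW.integral_div_le_windowMass hd hL hn).1).trans_le hN
  set w := (∫ θ in (-π)..π, W θ) / N with hw
  obtain ⟨x, hx⟩ := hnodes W hW hd n hn N hN
    (fun j : Finset.Icc 1 n × Bool => fun θ : ℝ =>
      bif j.2 then Real.cos ((j.1 : ℕ) * θ) else Real.sin ((j.1 : ℕ) * θ)) (by
      rintro ⟨⟨k, hk⟩, b⟩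
      have hk' := (Finset.mem_Icc.1 hk).2
      cases b
      · exact IsTrigPoly.sin_nat hk'
      · exact IsTrigPoly.cos_nat hk')
  have hcos : ∀ k ∈ Finset.Icc 1 n,
      ∫ θ in (-π)..π, Real.cos (k * θ) * W θ = w * ∑ i, Real.cos (k * x i) :=
    fun k hk => hx (⟨k, hk⟩, true)
  have hsin : ∀ k ∈ Finset.Icc 1 n,
      ∫ θ in (-π)..π, Real.sin (k * θ) * W θ = w * ∑ i, Real.sin (k * x i) :=
    fun k hk => hx (⟨k, hk⟩, false)
  refine ⟨x ∘ Tuple.sort x, Tuple.monotone_sort x, fun p hp => ?_⟩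
  simp only [Function.comp_apply]
  rw [Equiv.sum_comp (Tuple.sort x) fun i => p (x i), ← hw]
  obtain ⟨a, b, hab⟩ := hp
  have hi := fun {g : ℝ → ℝ} (hg : Continuous g) => hW.intervalIntegrable_mul hg (-π) π
  have hterm : ∀ k ∈ Finset.Icc 1 n,
      ∫ θ in (-π)..π, (a k * Real.cos (k * θ) + b k * Real.sin (k * θ)) * W θ =
        w * ∑ i, (a k * Real.cos (k * x i) + b k * Real.sin (k * x i)) := fun k hk => by
    simp only [add_mul, mul_assoc]
    rw [intervalIntegral.integral_add ((hi (by fun_prop)).const_mul _)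
      ((hi (by fun_prop)).const_mul _), intervalIntegral.integral_const_mul,
      intervalIntegral.integral_const_mul, hcos k hk, hsin k hk, Finset.sum_add_distrib,
      ← Finset.mul_sum, ← Finset.mul_sum]
    ring
  have hexp : ∀ θ, p θ * W θ = a 0 * W θ +
      (∑ k ∈ Finset.Icc 1 n, (a k * Real.cos (k * θ) + b k * Real.sin (k * θ))) * W θ :=
    fun θ => by rw [hab, add_mul]
  simp only [hexp]
  rw [intervalIntegral.integral_add (hi continuous_const) (hi (by fun_prop))]
  simp only [Finset.sum_mul]
  rw [intervalIntegral.integral_finsetSum fun k _ => hi (by fun_prop), Finset.sum_congr rfl hterm,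
    intervalIntegral.integral_const_mul]
  simp only [hab]
  rw [Finset.sum_add_distrib, Finset.sum_comm, ← Finset.mul_sum, mul_add, Finset.sum_const,
    Finset.card_univ, Fintype.card_fin, nsmul_eq_mul, hw]
  field_simp

theorem trig_chebyshev_quadrature_doubling_weight (L : ℝ) (hL : 2 ≤ L) :
    ∃ c > (0:ℝ), ∃ C > (0:ℝ),
      ∀ W : ℝ → ℝ, IsPeriodicWeight W → IsDoublingPeriodic W L → ∀ n : ℕ, 1 ≤ n →
        (∀ N : ℕ, ∀ θs : Fin N → ℝ, IsTrigChebQuad W n N θs → c * Rtrig W n ≤ N) ∧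
        (∀ N : ℕ, C * Rtrig W n ≤ N → ∃ θs : Fin N → ℝ, IsTrigChebQuad W n N θs) := by
  have hL₀ : 0 < L := two_pos.trans_le hL
  obtain ⟨c, hc, hlow⟩ := exists_mul_Rtrig_le_card hL₀.le
  obtain ⟨C, hC, hup⟩ := IsTrigChebQuad.exists_of_mul_Rtrig_le hL₀
  exact ⟨c, hc, C, hC, fun W hW hd n hn => ⟨hlow W hW hd n hn, hup W hW hd n hn⟩⟩
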